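/- There exists a constant c > 0, depending only on the structural parameters N₀, c₀, β, such that for every n ≥ n₀ and all S₁, S₂ ∈ S(n,1): |S₁|_{BV(Ω)} ≤ |S₂|_{BV(Ω)} + c · n^{1/2} · ‖S₁ − S₂‖_{L²(Ω)}. -/

import Mathlib

open scoped Classical

open Set Metric MeasureTheory ENNReal

noncomputable section

/-- The Euclidean plane `ℝ²`. -/
abbrev Plane : Type := EuclideanSpace ℝ (Fin 2)

/-- `Q` is a compact regular convex set whose boundary is a polygon consisting of at most
`N₀` line segments, with eccentricity bounded by `c₀`. -/
def IsRegularConvexPolygon (N₀ : ℕ) (c₀ : ℝ) (Q : Set Plane) : Prop :=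
  IsCompact Q ∧ Convex ℝ Q ∧ Q.Nonempty ∧
    (∃ (m : ℕ) (v w : Fin m → Plane), m ≤ N₀ ∧ frontier Q = ⋃ i, segment ℝ (v i) (w i)) ∧
    (∃ (x₁ x₂ : Plane) (r₁ r₂ : ℝ), 0 < r₂ ∧
      closedBall x₂ r₂ ⊆ Q ∧ Q ⊆ closedBall x₁ r₁ ∧ r₁ ≤ c₀ * r₂)

/-- There is a triangle contained in `R` having the segment `[a,b]` as a side, whose two
angles adjacent to that side are equal to `β`. -/
def HasGoodTriangle (β : ℝ) (R : Set Plane) (a b : Plane) : Prop :=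
  ∃ c : Plane, convexHull ℝ {a, b, c} ⊆ R ∧
    EuclideanGeometry.angle b a c = β ∧ EuclideanGeometry.angle a b c = β

/-- `R ⊆ ℝ²` is a ring with structural parameters `N₀`, `c₀`, `β`: the difference of two
regular compact convex sets with polygonal boundaries, admitting no uncontrollably narrow
elongated subregions (each maximal edge of the boundary can be subdivided into at most two
segments, each carrying a good triangle with adjacent angles `β` inside `R`). -/
def IsRing (N₀ : ℕ) (c₀ β : ℝ) (R : Set Plane) : Prop :=
  (∃ Q₁ Q₂ : Set Plane,
      IsRegularConvexPolygon N₀ c₀ Q₁ ∧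
      (Q₂ = ∅ ∨ (Q₂ ⊆ Q₁ ∧ IsRegularConvexPolygon N₀ c₀ Q₂)) ∧
      R = Q₁ \ interior Q₂) ∧
  (∃ (m : ℕ) (v w : Fin m → Plane),
      frontier R = ⋃ i, segment ℝ (v i) (w i) ∧
      (∀ i, ∀ a b : Plane, segment ℝ (v i) (w i) ⊆ segment ℝ a b →
        segment ℝ a b ⊆ frontier R → segment ℝ a b = segment ℝ (v i) (w i)) ∧
      (∀ i, ∃ p ∈ segment ℝ (v i) (w i),
        HasGoodTriangle β R (v i) p ∧ HasGoodTriangle β R p (w i)))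

/-- `Ω` is the union of `n` rings with pairwise disjoint interiors. -/
def IsRingDecomp (N₀ : ℕ) (c₀ β : ℝ) (n : ℕ) (Ω : Set Plane) : Prop :=
  ∃ R : Fin n → Set Plane,
    (∀ j, IsRing N₀ c₀ β (R j)) ∧
    (∀ i j, i ≠ j → interior (R i) ∩ interior (R j) = ∅) ∧
    (⋃ j, R j) = Ω

/-- Membership in the nonlinear spline class `S(n,k)`: piecewise polynomials of total degree
`< k` over `n` rings with pairwise disjoint interiors whose union is `Ω` (or, when `Ω = ℝ²`,
whose union -- the support of the spline -- is itself a ring), having maximum smoothness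
`W^{k-2}(Ω)` when `k ≥ 2` (no smoothness is required for piecewise constants, `k = 1`). -/
def IsSpline (N₀ : ℕ) (c₀ β : ℝ) (n k : ℕ) (Ω : Set Plane) (S : Plane → ℝ) : Prop :=
  ∃ (R : Fin n → Set Plane) (P : Fin n → MvPolynomial (Fin 2) ℝ),
    (∀ j, IsRing N₀ c₀ β (R j)) ∧
    (∀ i j, i ≠ j → interior (R i) ∩ interior (R j) = ∅) ∧
    ((⋃ j, R j) = Ω ∨ (Ω = Set.univ ∧ IsRing N₀ c₀ β (⋃ j, R j))) ∧
    (∀ j, (P j).totalDegree < k) ∧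
    (S = fun x => ∑ j, (R j).indicator (fun y => MvPolynomial.eval (fun i => y i) (P j)) x) ∧
    (2 ≤ k → ContDiffOn ℝ ((k - 2 : ℕ) : ℕ∞) S Ω)

/-- The spline class `S(n,k,r)` with defect: smoothness `W^r(Ω)` instead of the maximal
smoothness `W^{k-2}(Ω)`. -/
def IsSplineDefect (N₀ : ℕ) (c₀ β : ℝ) (n k r : ℕ) (Ω : Set Plane) (S : Plane → ℝ) : Prop :=
  ∃ (R : Fin n → Set Plane) (P : Fin n → MvPolynomial (Fin 2) ℝ),
    (∀ j, IsRing N₀ c₀ β (R j)) ∧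
    (∀ i j, i ≠ j → interior (R i) ∩ interior (R j) = ∅) ∧
    ((⋃ j, R j) = Ω ∨ (Ω = Set.univ ∧ IsRing N₀ c₀ β (⋃ j, R j))) ∧
    (∀ j, (P j).totalDegree < k) ∧
    (S = fun x => ∑ j, (R j).indicator (fun y => MvPolynomial.eval (fun i => y i) (P j)) x) ∧
    ContDiffOn ℝ ((r : ℕ) : ℕ∞) S Ω

/-- The `L^p(Ω)` quasi-norm, `0 < p < ∞`. -/
def lpNormE (p : ℝ) (Ω : Set Plane) (f : Plane → ℝ) : ℝ≥0∞ :=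
  eLpNorm f (ENNReal.ofReal p) (volume.restrict Ω)

/-- `k`-th finite difference `Δ_h^k f(x)`, set to `0` unless the segment `[x, x+kh] ⊆ Ω`. -/
def deltah (Ω : Set Plane) (k : ℕ) (h : Plane) (f : Plane → ℝ) (x : Plane) : ℝ :=
  if segment ℝ x (x + (k : ℝ) • h) ⊆ Ω then
    ∑ ν ∈ Finset.range (k + 1), (-1 : ℝ) ^ (k + ν) * (k.choose ν : ℝ) * f (x + (ν : ℝ) • h)
  else 0

/-- Modulus of smoothness `ω_k(f,t)_τ = sup_{|h| ≤ t} ‖Δ_h^k f‖_{L^τ(Ω)}`. -/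
def modulus (Ω : Set Plane) (k : ℕ) (τ : ℝ) (f : Plane → ℝ) (t : ℝ) : ℝ≥0∞ :=
  ⨆ (h : Plane) (_ : ‖h‖ ≤ t), lpNormE τ Ω (deltah Ω k h f)

/-- Besov seminorm `|f|_{B^{s,k}_τ} = (∫₀^∞ [t^{-s} ω_k(f,t)_τ]^τ dt/t)^{1/τ}`. -/
def besovSeminorm (Ω : Set Plane) (k : ℕ) (s τ : ℝ) (f : Plane → ℝ) : ℝ≥0∞ :=
  (∫⁻ t in Set.Ioi (0 : ℝ),
      (ENNReal.ofReal (t ^ (-s)) * modulus Ω k τ f t) ^ τ / ENNReal.ofReal t) ^ (1 / τ)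

/-- Error of best `L^p(Ω)`-approximation `S_n^k(f)_p` from the spline class `S(n,k)`. -/
def splineApprox (N₀ : ℕ) (c₀ β : ℝ) (n k : ℕ) (p : ℝ) (Ω : Set Plane) (f : Plane → ℝ) :
    ℝ≥0∞ :=
  ⨅ (S : Plane → ℝ) (_ : IsSpline N₀ c₀ β n k Ω S), lpNormE p Ω fun x => f x - S x

/-- The K-functional `K(f,t; L^p(Ω), B^{s,k}_τ)`. -/
def kFunctional (Ω : Set Plane) (k : ℕ) (s τ p : ℝ) (f : Plane → ℝ) (t : ℝ) : ℝ≥0∞ :=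
  ⨅ g : Plane → ℝ,
    lpNormE p Ω (fun x => f x - g x) + ENNReal.ofReal t * besovSeminorm Ω k s τ g

/-- BV seminorm: the total mass of the distributional gradient of `g` on `Ω`, defined by
duality against compactly supported `C¹` vector fields of norm at most one. -/
def bvSeminorm (Ω : Set Plane) (g : Plane → ℝ) : ℝ≥0∞ :=
  ⨆ (φ : Plane → Plane) (_ : ContDiff ℝ 1 φ ∧ HasCompactSupport φ ∧
      tsupport φ ⊆ interior Ω ∧ ∀ x, ‖φ x‖ ≤ 1),
    ENNReal.ofReal (∫ x in Ω, g x * ∑ i, fderiv ℝ φ x (EuclideanSpace.single i 1) i)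

/-- The K-functional `K(f,t; L²(Ω), BV(Ω))`. -/
def kFunctionalBV (Ω : Set Plane) (f : Plane → ℝ) (t : ℝ) : ℝ≥0∞ :=
  ⨅ g : Plane → ℝ,
    lpNormE 2 Ω (fun x => f x - g x) + ENNReal.ofReal t * bvSeminorm Ω g

/-- An oriented segment of the plane, given by its initial point, an orthonormal frame
(direction of the segment and a chosen unit normal) and its length. -/
structure Edge where
  base : Plane
  frame : OrthonormalBasis (Fin 2) ℝ Plane
  len : ℝ
  len_pos : 0 < len

namespace Edge

variable (e : Edge)

/-- The unit normal of an edge. -/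
def nor : Plane := e.frame 1

/-- The tangential coordinate of a point relative to an edge. -/
def s (x : Plane) : ℝ := inner ℝ (e.frame 0) (x - e.base)

/-- The normal coordinate of a point relative to an edge. -/
def t (x : Plane) : ℝ := inner ℝ e.nor (x - e.base)

/-- The point with given coordinates relative to an edge. -/
def pt (s t : ℝ) : Plane := e.base + s • e.frame 0 + t • e.nor

/-- The distance, along the edge, from the point with coordinate `s` to the nearest endpoint. -/
def gap (s : ℝ) : ℝ := min s (e.len - s)

/-- The open isosceles triangle over an edge whose base angles have tangent `τ`. -/
def tri (τ : ℝ) : Set Plane := {x | 0 < e.t x ∧ e.t x < τ * e.s x ∧ e.t x < τ * (e.len - e.s x)}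

/-- The closed segment underlying an edge. -/
def seg : Set Plane := {x | e.t x = 0 ∧ 0 ≤ e.s x ∧ e.s x ≤ e.len}

lemma norm_nor : ‖e.nor‖ = 1 := e.frame.orthonormal.1 1

lemma inner_frame_nor : inner ℝ (e.frame 0) e.nor = 0 := e.frame.orthonormal.2 (by decide)

@[simp] lemma s_pt (a b : ℝ) : e.s (e.pt a b) = a := by
  have h0 : inner ℝ (e.frame 0) (e.frame 0) = (1 : ℝ) := by
    rw [real_inner_self_eq_norm_sq, e.frame.orthonormal.1 0, one_pow]
  have : e.pt a b - e.base = a • e.frame 0 + b • e.nor := by rw [pt]; abel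
  rw [s, this, inner_add_right, inner_smul_right, inner_smul_right, h0, e.inner_frame_nor]
  ring

@[simp] lemma t_pt (a b : ℝ) : e.t (e.pt a b) = b := by
  have h0 : inner ℝ e.nor e.nor = (1 : ℝ) := by
    rw [real_inner_self_eq_norm_sq, e.norm_nor, one_pow]
  have : e.pt a b - e.base = a • e.frame 0 + b • e.nor := by rw [pt]; abel
  rw [t, this, inner_add_right, inner_smul_right, inner_smul_right, h0, real_inner_comm,
    e.inner_frame_nor]
  ring

@[simp] lemma pt_s_t (x : Plane) : e.pt (e.s x) (e.t x) = x := by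
  have := e.frame.sum_repr' (x - e.base)
  rw [Fin.sum_univ_two] at this
  rw [pt, s, t, nor, add_assoc, this]
  abel

lemma s_sub (x y : Plane) : e.s x - e.s y = inner ℝ (e.frame 0) (x - y) := by
  rw [s, s, ← inner_sub_right]; congr 1; abel

lemma t_sub (x y : Plane) : e.t x - e.t y = inner ℝ e.nor (x - y) := by
  rw [t, t, ← inner_sub_right]; congr 1; abel

lemma dist_sq (x y : Plane) : dist x y ^ 2 = (e.s x - e.s y) ^ 2 + (e.t x - e.t y) ^ 2 := by
  have := e.frame.sum_sq_norm_inner_right (x - y)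
  rw [Fin.sum_univ_two, Real.norm_eq_abs, Real.norm_eq_abs, sq_abs, sq_abs] at this
  rw [s_sub, t_sub, dist_eq_norm, ← this, nor]

lemma abs_s_sub_le (x y : Plane) : |e.s x - e.s y| ≤ dist x y := by
  apply abs_le_of_sq_le_sq _ dist_nonneg
  rw [e.dist_sq]; nlinarith [sq_nonneg (e.t x - e.t y)]

lemma abs_t_sub_le (x y : Plane) : |e.t x - e.t y| ≤ dist x y := by
  apply abs_le_of_sq_le_sq _ dist_nonneg
  rw [e.dist_sq]; nlinarith [sq_nonneg (e.s x - e.s y)]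

lemma dist_le (x y : Plane) : dist x y ≤ |e.s x - e.s y| + |e.t x - e.t y| := by
  apply le_of_sq_le_sq _ (by positivity)
  rw [e.dist_sq, ← sq_abs (e.s x - e.s y), ← sq_abs (e.t x - e.t y)]
  nlinarith [abs_nonneg (e.s x - e.s y), abs_nonneg (e.t x - e.t y)]

lemma continuous_s : Continuous e.s := by unfold s; fun_prop

lemma continuous_t : Continuous e.t := by unfold t; fun_prop

lemma continuous_gap : Continuous e.gap := by unfold gap; fun_prop

lemma s_combo (a b : ℝ) (h : a + b = 1) (x y : Plane) :
    e.s (a • x + b • y) = a * e.s x + b * e.s y := by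
  have : a • x + b • y - e.base = a • (x - e.base) + b • (y - e.base) := by
    rw [smul_sub, smul_sub]
    calc _ = a • x + b • y - (a + b) • e.base := by rw [h, one_smul]
      _ = _ := by rw [add_smul]; abel
  rw [s, this, inner_add_right, inner_smul_right, inner_smul_right]; rfl

lemma t_combo (a b : ℝ) (h : a + b = 1) (x y : Plane) :
    e.t (a • x + b • y) = a * e.t x + b * e.t y := by
  have : a • x + b • y - e.base = a • (x - e.base) + b • (y - e.base) := by
    rw [smul_sub, smul_sub]
    calc _ = a • x + b • y - (a + b) • e.base := by rw [h, one_smul]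
      _ = _ := by rw [add_smul]; abel
  rw [t, this, inner_add_right, inner_smul_right, inner_smul_right]; rfl

lemma isOpen_tri (τ : ℝ) : IsOpen (e.tri τ) := by
  have hs := e.continuous_s
  have ht := e.continuous_t
  exact (isOpen_lt continuous_const ht).inter ((isOpen_lt ht (continuous_const.mul hs)).inter
    (isOpen_lt ht (continuous_const.mul (continuous_const.sub hs))))

lemma convex_tri (τ : ℝ) : Convex ℝ (e.tri τ) := by
  rintro x ⟨h1, h2, h3⟩ y ⟨h1', h2', h3'⟩ a b ha hb hab
  simp only [tri, mem_ofPred_eq, e.t_combo a b hab, e.s_combo a b hab]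
  have hb' : b = 1 - a := by linarith
  rcases ha.eq_or_lt with rfl | ha0
  · have : b = 1 := by linarith
    subst this; simp; exact ⟨h1', h2', h3'⟩
  · refine ⟨by nlinarith, ?_, ?_⟩
    · nlinarith [mul_lt_mul_of_pos_left h2 ha0, mul_le_mul_of_nonneg_left h2'.le hb]
    · have e1 := mul_lt_mul_of_pos_left h3 ha0
      have e2 := mul_le_mul_of_nonneg_left h3'.le hb
      have : τ * (e.len - (a * e.s x + b * e.s y))
        = a * (τ * (e.len - e.s x)) + b * (τ * (e.len - e.s y)) := by
        rw [hb']; ring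
      linarith

lemma mem_tri_iff {τ : ℝ} (hτ : 0 < τ) {x : Plane} :
    x ∈ e.tri τ ↔ 0 < e.t x ∧ e.t x < τ * e.gap (e.s x) := by
  rw [gap, mul_min_of_nonneg _ _ hτ.le, lt_min_iff]; rfl

lemma s_mem_of_mem_tri {τ : ℝ} (hτ : 0 < τ) {x : Plane} (hx : x ∈ e.tri τ) :
    e.s x ∈ Ioo 0 e.len := by
  obtain ⟨h1, h2, h3⟩ := hx
  constructor
  · exact pos_of_mul_pos_right (h1.trans h2) hτ.le
  · linarith [pos_of_mul_pos_right (h1.trans h3) hτ.le]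

lemma gap_pos {a : ℝ} (ha : a ∈ Ioo 0 e.len) : 0 < e.gap a :=
  lt_min ha.1 (by linarith [ha.2])

lemma gap_le (a : ℝ) : e.gap a ≤ e.len / 2 := by
  rcases le_total a (e.len - a) with h | h
  · rw [gap, min_eq_left h]; linarith
  · rw [gap, min_eq_right h]; linarith

/-- The coordinate chart of an edge. -/
def chart : ℝ × ℝ → Plane := fun p => e.pt p.1 p.2

lemma measurePreserving_chart : MeasurePreserving e.chart := by
  have h1 := (volume_preserving_finTwoArrow ℝ).symm
  have h2 := PiLp.volume_preserving_toLp (ι := Fin 2)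
  have h3 := e.frame.measurePreserving_repr_symm
  have h4 := measurePreserving_add_left (volume : Measure Plane) e.base
  have h : e.chart = (fun x => e.base + x) ∘ e.frame.repr.symm ∘ WithLp.toLp 2 ∘
      MeasurableEquiv.finTwoArrow.symm := by
    funext p
    simp only [chart, pt, Function.comp, nor, add_assoc]
    congr 1
    rw [← e.frame.sum_repr_symm, Fin.sum_univ_two]
    rfl
  rw [h]
  exact h4.comp (h3.comp (h2.comp h1))

lemma continuous_chart : Continuous e.chart := by unfold chart pt; fun_prop

lemma measurableEmbedding_chart : MeasurableEmbedding e.chart := by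
  apply Continuous.measurableEmbedding e.continuous_chart
  intro p q h
  have h1 := congrArg e.s h
  have h2 := congrArg e.t h
  simp only [chart, s_pt, t_pt] at h1 h2
  exact Prod.ext h1 h2

variable {τ : ℝ}

lemma continuous_pt (a : ℝ) : Continuous (e.pt a) := by unfold pt; fun_prop

lemma measurableSet_tri : MeasurableSet (e.tri τ) := (e.isOpen_tri τ).measurableSet

lemma pt_mem_tri (hτ : 0 < τ) (a b : ℝ) : e.pt a b ∈ e.tri τ ↔ b ∈ Ioo 0 (τ * e.gap a) := by
  rw [e.mem_tri_iff hτ, s_pt, t_pt]; rfl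

lemma Ioo_gap_eq_empty (hτ : 0 < τ) {a : ℝ} (ha : a ∉ Ioo 0 e.len) :
    Ioo 0 (τ * e.gap a) = ∅ := by
  refine Ioo_eq_empty (not_lt.2 (mul_nonpos_of_nonneg_of_nonpos hτ.le ?_))
  by_contra! h
  rw [gap, lt_min_iff] at h
  exact ha ⟨h.1, by linarith [h.2]⟩

lemma lintegral_tri (hτ : 0 < τ) {F : Plane → ℝ≥0∞} (hF : Measurable F) :
    ∫⁻ x in e.tri τ, F x
      = ∫⁻ a in Ioo 0 e.len, ∫⁻ b in Ioo 0 (τ * e.gap a), F (e.pt a b) := by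
  have hm : Measurable fun p => (e.tri τ).indicator F (e.chart p) :=
    (hF.indicator e.measurableSet_tri).comp e.continuous_chart.measurable
  rw [← lintegral_indicator e.measurableSet_tri,
    ← e.measurePreserving_chart.lintegral_comp (hF.indicator e.measurableSet_tri),
    Measure.volume_eq_prod, lintegral_prod _ hm.aemeasurable,
    ← setLIntegral_eq_of_support_subset (s := Ioo 0 e.len)]
  · refine setLIntegral_congr_fun measurableSet_Ioo fun a _ => ?_
    rw [← lintegral_indicator measurableSet_Ioo]
    congr 1; ext b
    simp only [indicator, chart, e.pt_mem_tri hτ]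
  · intro a ha
    by_contra h
    apply ha
    simp only [indicator, chart, e.pt_mem_tri hτ, e.Ioo_gap_eq_empty hτ h]
    simp

lemma integral_tri (hτ : 0 < τ) {F : Plane → ℝ} (hF : IntegrableOn F (e.tri τ)) :
    ∫ x in e.tri τ, F x = ∫ a in Ioo 0 e.len, ∫ b in Ioo 0 (τ * e.gap a), F (e.pt a b) := by
  have hi : Integrable ((e.tri τ).indicator F) := hF.integrable_indicator e.measurableSet_tri
  have hi' := (e.measurePreserving_chart.integrable_comp_emb e.measurableEmbedding_chart).2 hi
  rw [← integral_indicator e.measurableSet_tri,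
    ← e.measurePreserving_chart.integral_comp e.measurableEmbedding_chart]
  rw [Measure.volume_eq_prod] at hi' ⊢
  have := integral_prod _ hi'
  simp only [Function.comp] at this
  rw [this, ← setIntegral_eq_integral_of_forall_compl_eq_zero (s := Ioo 0 e.len)]
  · refine setIntegral_congr_fun measurableSet_Ioo fun a _ => ?_
    rw [← integral_indicator measurableSet_Ioo]
    congr 1; ext b
    simp only [indicator, chart, e.pt_mem_tri hτ]
  · intro a h
    simp only [indicator, chart, e.pt_mem_tri hτ, e.Ioo_gap_eq_empty hτ h]
    simp

lemma measure_setOf_t_eq (c : ℝ) : volume {x | e.t x = c} = 0 := by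
  have hm : MeasurableSet {x | e.t x = c} :=
    (isClosed_eq e.continuous_t continuous_const).measurableSet
  rw [← e.measurePreserving_chart.measure_preimage hm.nullMeasurableSet]
  have : e.chart ⁻¹' {x | e.t x = c} = univ ×ˢ {c} := by
    ext p; simp [chart]
  rw [this, Measure.volume_eq_prod, Measure.prod_prod]
  simp

/-- The weight equal to the reciprocal of the height of the triangle `e.tri τ` above the foot
of the point. -/
def weight (τ : ℝ) (x : Plane) : ℝ := (τ * e.gap (e.s x))⁻¹

lemma measurable_weight (τ : ℝ) : Measurable (e.weight τ) :=
  (measurable_const.mul (e.continuous_gap.comp e.continuous_s).measurable).inv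

lemma weight_pos (hτ : 0 < τ) {x : Plane} (hx : x ∈ e.tri τ) : 0 < e.weight τ x :=
  inv_pos.2 (mul_pos hτ (e.gap_pos (e.s_mem_of_mem_tri hτ hx)))

lemma lintegral_weight (hτ : 0 < τ) {h : ℝ → ℝ≥0∞} (hh : Measurable h) :
    ∫⁻ x in e.tri τ, h (e.s x) * ENNReal.ofReal (e.weight τ x) = ∫⁻ a in Ioo 0 e.len, h a := by
  have hm : Measurable fun x => h (e.s x) * ENNReal.ofReal (e.weight τ x) :=
    (hh.comp e.continuous_s.measurable).mul (e.measurable_weight τ).ennreal_ofReal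
  rw [e.lintegral_tri hτ hm]
  refine setLIntegral_congr_fun measurableSet_Ioo fun a ha => ?_
  have hp : 0 < τ * e.gap a := mul_pos hτ (e.gap_pos ha)
  simp only [s_pt, weight, lintegral_const, Measure.restrict_apply_univ, Real.volume_Ioo, sub_zero]
  rw [mul_assoc, ← ENNReal.ofReal_mul (inv_nonneg.2 hp.le), inv_mul_cancel₀ hp.ne']
  simp

lemma integrableOn_weight (hτ : 0 < τ) : IntegrableOn (e.weight τ) (e.tri τ) := by
  refine ⟨(e.measurable_weight τ).aestronglyMeasurable, ?_⟩
  have h := e.lintegral_weight hτ (h := fun _ => 1) measurable_const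
  rw [hasFiniteIntegral_iff_ofReal]
  · simp only [one_mul] at h
    rw [h]; simp
  · filter_upwards [ae_restrict_mem e.measurableSet_tri] with x hx
    exact (e.weight_pos hτ hx).le

lemma tri_subset_closedBall (hτ : 0 < τ) : e.tri τ ⊆ closedBall e.base ((1 + τ) * e.len) := by
  intro x hx
  have hs := e.s_mem_of_mem_tri hτ hx
  have h := (e.mem_tri_iff hτ).1 hx
  have hg := e.gap_le (e.s x)
  have hb1 : e.s e.base = 0 := by simp [s]
  have hb2 : e.t e.base = 0 := by simp [t]
  have := e.dist_le x e.base
  rw [hb1, hb2, sub_zero, sub_zero, abs_of_pos hs.1, abs_of_pos h.1] at this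
  rw [mem_closedBall]
  have h3 : τ * e.gap (e.s x) ≤ τ * e.len :=
    mul_le_mul_of_nonneg_left (by linarith [e.len_pos]) hτ.le
  linarith [hs.2]

lemma measure_tri_lt_top (hτ : 0 < τ) : volume (e.tri τ) < ∞ :=
  (measure_mono (e.tri_subset_closedBall hτ)).trans_lt measure_closedBall_lt_top

lemma integrableOn_tri_of_continuous (hτ : 0 < τ) {F : Plane → ℝ} (hF : Continuous F) :
    IntegrableOn F (e.tri τ) :=
  (hF.continuousOn.integrableOn_compact (isCompact_closedBall _ _)).mono_set
    (e.tri_subset_closedBall hτ)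

/-- The function on the triangle `e.tri τ` equal to `1` on the base, to `0` on the two other
sides, and affine in the normal direction. -/
def hat (τ : ℝ) (x : Plane) : ℝ := 1 - e.t x * e.weight τ x

lemma measurable_hat (τ : ℝ) : Measurable (e.hat τ) :=
  measurable_const.sub (e.continuous_t.measurable.mul (e.measurable_weight τ))

lemma hat_mem_Icc (hτ : 0 < τ) {x : Plane} (hx : x ∈ e.tri τ) : e.hat τ x ∈ Icc 0 1 := by
  have h := (e.mem_tri_iff hτ).1 hx
  have hp : 0 < τ * e.gap (e.s x) := h.1.trans h.2
  have h1 : e.t x * e.weight τ x ≤ 1 := by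
    rw [weight, ← div_eq_mul_inv, div_le_one hp]; exact h.2.le
  have h2 := mul_nonneg h.1.le (e.weight_pos hτ hx).le
  constructor <;> simp only [hat] <;> linarith

lemma hasDerivAt_comp_pt {u : Plane → ℝ} (hu : ContDiff ℝ 1 u) (a b : ℝ) :
    HasDerivAt (fun b => u (e.pt a b)) (fderiv ℝ u (e.pt a b) e.nor) b := by
  have h1 : HasDerivAt (fun b => e.pt a b) e.nor b := by
    unfold pt
    simpa using ((hasDerivAt_id b).smul_const e.nor).const_add (e.base + a • e.frame 0)
  exact ((hu.differentiable one_ne_zero _).hasFDerivAt).comp_hasDerivAt b h1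

lemma integrableOn_hat_mul (hτ : 0 < τ) {F : Plane → ℝ} (hF : Continuous F) :
    IntegrableOn (fun x => e.hat τ x * F x) (e.tri τ) := by
  refine (e.integrableOn_tri_of_continuous hτ hF).bdd_mul (c := 1)
    (e.measurable_hat τ).aestronglyMeasurable ?_
  filter_upwards [ae_restrict_mem e.measurableSet_tri] with x hx
  have := e.hat_mem_Icc hτ hx
  rw [Real.norm_eq_abs, abs_of_nonneg this.1]; exact this.2

lemma integrableOn_weight_mul (hτ : 0 < τ) {F : Plane → ℝ} (hF : Continuous F) :
    IntegrableOn (fun x => e.weight τ x * F x) (e.tri τ) := by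
  obtain ⟨C, hC⟩ := (isCompact_closedBall e.base ((1 + τ) * e.len)).exists_bound_of_continuousOn
    hF.continuousOn
  refine (e.integrableOn_weight hτ).mul_bdd (c := C) hF.aestronglyMeasurable ?_
  filter_upwards [ae_restrict_mem e.measurableSet_tri] with x hx
  exact hC x (e.tri_subset_closedBall hτ hx)

/-- Integration by parts in the normal direction on the triangle over an edge. -/
lemma integral_tri_hat_mul (hτ : 0 < τ) {u : Plane → ℝ} (hu : ContDiff ℝ 1 u) {g : ℝ → ℝ}
    (hg : Continuous g) :
    ∫ x in e.tri τ, e.hat τ x * (g (e.s x) * fderiv ℝ u x e.nor)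
      = (∫ x in e.tri τ, e.weight τ x * (g (e.s x) * u x))
        - ∫ a in Ioo 0 e.len, g a * u (e.pt a 0) := by
  have hgs : Continuous fun x => g (e.s x) := hg.comp e.continuous_s
  have hdu : Continuous fun x => fderiv ℝ u x e.nor :=
    (hu.continuous_fderiv one_ne_zero).clm_apply continuous_const
  have i1 : IntegrableOn (fun x => e.hat τ x * (g (e.s x) * fderiv ℝ u x e.nor)) (e.tri τ) :=
    e.integrableOn_hat_mul hτ (hgs.mul hdu)
  have i2 : IntegrableOn (fun x => e.weight τ x * (g (e.s x) * u x)) (e.tri τ) :=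
    e.integrableOn_weight_mul hτ (hgs.mul hu.continuous)
  have hsub := integral_sub i1 i2
  rw [e.integral_tri hτ (F := fun x => e.hat τ x * (g (e.s x) * fderiv ℝ u x e.nor)
    - e.weight τ x * (g (e.s x) * u x)) (i1.sub i2)] at hsub
  have : ∫ a in Ioo 0 e.len, ∫ b in Ioo 0 (τ * e.gap a),
      (e.hat τ (e.pt a b) * (g (e.s (e.pt a b)) * fderiv ℝ u (e.pt a b) e.nor)
        - e.weight τ (e.pt a b) * (g (e.s (e.pt a b)) * u (e.pt a b)))
      = ∫ a in Ioo 0 e.len, -(g a * u (e.pt a 0)) := by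
    refine setIntegral_congr_fun measurableSet_Ioo fun a ha => ?_
    have hp : 0 < τ * e.gap a := mul_pos hτ (e.gap_pos ha)
    simp only [hat, weight, s_pt, t_pt]
    rw [← integral_Ioc_eq_integral_Ioo, ← intervalIntegral.integral_of_le hp.le]
    have hd : ∀ b ∈ uIcc 0 (τ * e.gap a),
        HasDerivAt (fun b => (1 - b * (τ * e.gap a)⁻¹) * (g a * u (e.pt a b)))
          ((1 - b * (τ * e.gap a)⁻¹) * (g a * fderiv ℝ u (e.pt a b) e.nor)
            - (τ * e.gap a)⁻¹ * (g a * u (e.pt a b))) b := by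
      intro b _
      have h1 : HasDerivAt (fun b => 1 - b * (τ * e.gap a)⁻¹) (-(τ * e.gap a)⁻¹) b := by
        simpa using ((hasDerivAt_id b).mul_const (τ * e.gap a)⁻¹).const_sub 1
      exact (h1.fun_mul ((e.hasDerivAt_comp_pt hu a b).const_mul (g a))).congr_deriv (by ring)
    have hpt := e.continuous_pt a
    have hc1 := hdu.comp hpt
    have hc2 := hu.continuous.comp hpt
    simp only [Function.comp_def] at hc1 hc2
    rw [intervalIntegral.integral_eq_sub_of_hasDerivAt hd
      (Continuous.intervalIntegrable (by fun_prop) _ _), mul_inv_cancel₀ hp.ne']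
    ring
  rw [this, integral_neg] at hsub
  linarith

lemma tendsto_integral_strip (hτ : 0 < τ) {F : Plane → ℝ} (hF : Continuous F) :
    Filter.Tendsto (fun δ : ℝ => δ⁻¹ * ∫ x in e.tri τ ∩ {x | e.t x < δ}, F x)
      (nhdsWithin 0 (Ioi 0)) (nhds (∫ a in Ioo 0 e.len, F (e.pt a 0))) := by
  obtain ⟨C, hC⟩ := (isCompact_closedBall e.base ((1 + τ) * e.len)).exists_bound_of_continuousOn
    hF.continuousOn
  have hms : ∀ δ, MeasurableSet {x | e.t x < δ} := fun δ =>
    (isOpen_lt e.continuous_t continuous_const).measurableSet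
  have hint := e.integrableOn_tri_of_continuous hτ hF
  have hpt : ∀ a, Continuous fun b => F (e.pt a b) := fun a => hF.comp (e.continuous_pt a)
  have h1 : ∀ δ : ℝ, ∫ x in e.tri τ ∩ {x | e.t x < δ}, F x
      = ∫ a in Ioo 0 e.len, ∫ b in Ioo 0 (min δ (τ * e.gap a)), F (e.pt a b) := by
    intro δ
    rw [← setIntegral_indicator (hms δ), e.integral_tri hτ (hint.indicator (hms δ))]
    refine setIntegral_congr_fun measurableSet_Ioo fun a ha => ?_
    have : ∀ b, {x | e.t x < δ}.indicator F (e.pt a b)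
        = (Iio δ).indicator (fun b => F (e.pt a b)) b := by
      intro b; simp [indicator]
    simp only [this]
    rw [setIntegral_indicator measurableSet_Iio]
    congr 2
    ext b; simp only [mem_inter_iff, mem_Ioo, mem_Iio, lt_min_iff]; tauto
  have h2 : ∀ δ : ℝ, δ⁻¹ * ∫ x in e.tri τ ∩ {x | e.t x < δ}, F x
      = ∫ a in Ioo 0 e.len, δ⁻¹ * ∫ b in Ioo 0 (min δ (τ * e.gap a)), F (e.pt a b) := by
    intro δ; rw [h1, integral_const_mul]
  simp only [h2]
  apply tendsto_integral_filter_of_dominated_convergence (fun _ => |C|)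
  · refine Filter.Eventually.of_forall fun δ => ?_
    have hm : Measurable fun p : ℝ × ℝ => (({x | e.t x < δ} ∩ e.tri τ).indicator F) (e.chart p) :=
      (hF.measurable.indicator ((hms δ).inter e.measurableSet_tri)).comp
        e.continuous_chart.measurable
    have h2 := (hm.stronglyMeasurable.integral_prod_right' (ν := volume)).aestronglyMeasurable
      (μ := volume.restrict (Ioo 0 e.len))
    refine (h2.const_mul δ⁻¹).congr (Filter.Eventually.of_forall fun a => ?_)
    change δ⁻¹ * _ = δ⁻¹ * _
    rw [← integral_indicator measurableSet_Ioo]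
    congr 2; funext b
    have : e.chart (a, b) ∈ {x | e.t x < δ} ∩ e.tri τ ↔ b ∈ Ioo 0 (min δ (τ * e.gap a)) := by
      rw [mem_inter_iff, chart, e.pt_mem_tri hτ]
      simp only [mem_Ioo, mem_ofPred_eq, lt_min_iff, t_pt]; tauto
    simp only [indicator, this]; rfl
  · filter_upwards [self_mem_nhdsWithin] with δ hδ
    filter_upwards [ae_restrict_mem measurableSet_Ioo] with a ha
    have hδ : 0 < δ := hδ
    have hp : 0 < τ * e.gap a := mul_pos hτ (e.gap_pos ha)
    have hb : ‖∫ b in Ioo 0 (min δ (τ * e.gap a)), F (e.pt a b)‖ ≤ |C| * δ := by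
      refine (norm_setIntegral_le_of_norm_le_const (C := |C|) (by simp) fun b hb => ?_).trans ?_
      · refine (hC _ (e.tri_subset_closedBall hτ ((e.pt_mem_tri hτ a b).2
          ⟨hb.1, hb.2.trans_le (min_le_right _ _)⟩))).trans (le_abs_self _)
      · refine mul_le_mul_of_nonneg_left ?_ (abs_nonneg _)
        rw [Measure.real, Real.volume_Ioo, sub_zero, ENNReal.toReal_ofReal (le_min hδ.le hp.le)]
        exact min_le_left _ _
    rw [norm_mul, norm_inv, Real.norm_of_nonneg hδ.le, inv_mul_le_iff₀ hδ, mul_comm δ]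
    exact hb
  · exact integrable_const _
  · filter_upwards [ae_restrict_mem measurableSet_Ioo] with a ha
    have hp : 0 < τ * e.gap a := mul_pos hτ (e.gap_pos ha)
    have hd : HasDerivAt (fun y => ∫ b in (0 : ℝ)..y, F (e.pt a b)) (F (e.pt a 0)) 0 :=
      intervalIntegral.integral_hasDerivAt_right (by simp)
        ((hpt a).stronglyMeasurableAtFilter _ _) (hpt a).continuousAt
    refine hd.tendsto_slope_zero_right.congr' ?_
    filter_upwards [Ioo_mem_nhdsGT hp] with δ hδ
    simp only [zero_add, intervalIntegral.integral_same, sub_zero, smul_eq_mul]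
    rw [min_eq_left hδ.2.le, intervalIntegral.integral_of_le hδ.1.le,
      integral_Ioc_eq_integral_Ioo]

end Edge

/-- The divergence of a vector field of the plane. -/
def divergence (φ : Plane → Plane) (x : Plane) : ℝ :=
  ∑ i, fderiv ℝ φ x (EuclideanSpace.single i 1) i

/-- If the disc around each point of the triangle which touches the base line is contained in `R`,
and if the base is contained in the boundary of `R`, then the normal coordinate is the distance to
the complement of `R`. -/
lemma Edge.infDist_compl_eq (e : Edge) {τ : ℝ} (hτ : 0 < τ) {R : Set Plane}
    (hb : ∀ x, 0 ≤ e.t x → e.t x ≤ τ * e.s x → e.t x ≤ τ * (e.len - e.s x) → ball x (e.t x) ⊆ R)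
    (hseg : e.seg ⊆ frontier R) {x : Plane} (hx : x ∈ e.tri τ) : infDist x Rᶜ = e.t x := by
  have hs := e.s_mem_of_mem_tri hτ hx
  have hf : e.pt (e.s x) 0 ∈ closure Rᶜ := by
    have : e.pt (e.s x) 0 ∈ frontier R := hseg ⟨by simp, by simpa using hs.1.le,
      by simpa using hs.2.le⟩
    rw [frontier_eq_closure_inter_closure] at this
    exact this.2
  apply le_antisymm
  · rw [← infDist_closure]
    refine (infDist_le_dist_of_mem hf).trans ?_
    have := e.dist_le x (e.pt (e.s x) 0)
    simpa [abs_of_pos hx.1] using this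
  · rw [le_infDist (closure_nonempty_iff.1 ⟨_, hf⟩)]
    intro y hy
    by_contra! hlt
    exact hy (hb x hx.1.le hx.2.1.le hx.2.2.le (by rwa [mem_ball, dist_comm]))

/-- A decomposition of the boundary of a compact set `R` into edges, with inner normals, carrying
pairwise disjoint triangles with base slope `τ` inside `R`. -/
structure EdgeSystem (τ : ℝ) (R : Set Plane) {ι : Type*} (e : ι → Edge) : Prop where
  isCompact : IsCompact R
  ball_subset : ∀ i x, 0 ≤ (e i).t x → (e i).t x ≤ τ * (e i).s x →
    (e i).t x ≤ τ * ((e i).len - (e i).s x) → ball x ((e i).t x) ⊆ R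
  frontier_eq : frontier R = ⋃ i, (e i).seg
  one_sided : ∀ i, ∃ A, ∀ x ∈ R, (e i).t x < 0 → 0 < (e i).s x → (e i).s x < (e i).len →
    (e i).gap ((e i).s x) ≤ A * |(e i).t x|
  disjoint : Pairwise fun i j => Disjoint ((e i).tri τ) ((e j).tri τ)

namespace EdgeSystem

variable {τ : ℝ} {R : Set Plane} {ι : Type*} {e : ι → Edge}

lemma seg_subset (h : EdgeSystem τ R e) (i : ι) : (e i).seg ⊆ frontier R := by
  rw [h.frontier_eq]; exact subset_iUnion (fun i => (e i).seg) i

lemma tri_subset (h : EdgeSystem τ R e) (i : ι) : (e i).tri τ ⊆ interior R := by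
  refine interior_maximal (fun x hx => ?_) ((e i).isOpen_tri τ)
  exact h.ball_subset i x hx.1.le hx.2.1.le hx.2.2.le (mem_ball_self hx.1)

lemma infDist_eq (h : EdgeSystem τ R e) (hτ : 0 < τ) (i : ι) {x : Plane} (hx : x ∈ (e i).tri τ) :
    infDist x Rᶜ = (e i).t x :=
  (e i).infDist_compl_eq hτ (h.ball_subset i) (h.seg_subset i) hx

lemma volume_frontier (h : EdgeSystem τ R e) [Finite ι] : volume (frontier R) = 0 := by
  rw [h.frontier_eq, measure_iUnion_null_iff]
  exact fun i => measure_mono_null (fun x hx => hx.1) ((e i).measure_setOf_t_eq 0)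

lemma nonempty_compl (h : EdgeSystem τ R e) : Rᶜ.Nonempty := by
  rw [Set.nonempty_compl]
  rintro rfl
  exact noncompact_univ Plane h.isCompact

lemma exists_mem_seg (h : EdgeSystem τ R e) {x : Plane} (hx : x ∈ interior R) :
    ∃ i, ∃ y ∈ (e i).seg, dist x y = infDist x Rᶜ := by
  obtain ⟨y, hy, hxy⟩ := isClosed_closure.exists_infDist_eq_dist h.nonempty_compl.closure x
  rw [infDist_closure] at hxy
  have hpos : 0 < infDist x Rᶜ := by
    rw [← infDist_closure, ← isClosed_closure.notMem_iff_infDist_pos h.nonempty_compl.closure,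
      closure_compl]
    exact fun h => h hx
  have hyR : y ∈ closure R := by
    have : ball x (infDist x Rᶜ) ⊆ R := by
      rw [← disjoint_compl_right_iff_subset]; exact disjoint_ball_infDist
    refine closure_mono this ?_
    rw [closure_ball _ hpos.ne', mem_closedBall, dist_comm, hxy]
  have : y ∈ frontier R := by rw [frontier_eq_closure_inter_closure]; exact ⟨hyR, hy⟩
  rw [h.frontier_eq, mem_iUnion] at this
  exact ⟨this.choose, y, this.choose_spec, hxy.symm⟩

/-- Points of `R` close to the boundary lie in one of the triangles or near the end of an edge. -/
lemma exists_const_mem_tri_or (h : EdgeSystem τ R e) (hτ : 0 < τ) [Fintype ι] :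
    ∃ C : ℝ, 0 ≤ C ∧ ∀ δ > 0, ∀ x ∈ interior R, infDist x Rᶜ ≤ δ → (∃ i, x ∈ (e i).tri τ) ∨
      ∃ i, x ∈ closedBall (e i).base (C * δ) ∪ closedBall ((e i).pt (e i).len 0) (C * δ) := by
  choose A hA using h.one_sided
  refine ⟨2 + τ⁻¹ + ∑ i, |A i|, by positivity, fun δ hδ x hx hxδ => ?_⟩
  obtain ⟨i, y, ⟨hy1, hy2, hy3⟩, hxy⟩ := h.exists_mem_seg hx
  rw [← hxy] at hxδ
  have hAi : |A i| ≤ ∑ i, |A i| :=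
    Finset.single_le_sum (f := fun i => |A i|) (fun _ _ => abs_nonneg _) (Finset.mem_univ i)
  set B := ∑ i, |A i|
  have hB : 0 ≤ B := (abs_nonneg _).trans hAi
  have hτ' : 0 < τ⁻¹ := inv_pos.2 hτ
  have hsx := ((e i).abs_s_sub_le x y).trans hxδ
  have htx := ((e i).abs_t_sub_le x y).trans hxδ
  rw [hy1, sub_zero] at htx
  have hb1 : (e i).s (e i).base = 0 := by simp [Edge.s]
  have hb2 : (e i).t (e i).base = 0 := by simp [Edge.t]
  by_cases h1 : (e i).s y ≤ (1 + τ⁻¹ + B) * δ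
  · right
    refine ⟨i, Or.inl ?_⟩
    rw [mem_closedBall]
    have h2 := (e i).dist_le y (e i).base
    rw [hb1, hb2, hy1, sub_zero, sub_zero, abs_zero, abs_of_nonneg hy2] at h2
    linarith [dist_triangle x y (e i).base]
  by_cases h1' : (e i).len - (e i).s y ≤ (1 + τ⁻¹ + B) * δ
  · right
    refine ⟨i, Or.inr ?_⟩
    rw [mem_closedBall]
    have h2 := (e i).dist_le y ((e i).pt (e i).len 0)
    rw [Edge.s_pt, Edge.t_pt, hy1, sub_zero, abs_zero, abs_of_nonpos (by linarith)] at h2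
    linarith [dist_triangle x y ((e i).pt (e i).len 0)]
  push Not at h1 h1'
  rw [abs_le] at hsx
  have hg : (τ⁻¹ + B) * δ < (e i).gap ((e i).s x) := lt_min (by linarith) (by linarith)
  have hBδ : 0 ≤ B * δ := by positivity
  have hτδ : 0 < τ⁻¹ * δ := by positivity
  have hg0 : 0 < (e i).gap ((e i).s x) := by linarith
  obtain ⟨g1, g2⟩ := lt_min_iff.1 hg0
  rcases lt_trichotomy ((e i).t x) 0 with ht | ht | ht
  · exfalso
    have := hA i x (interior_subset hx) ht g1 (by linarith)
    have h3 : A i * |(e i).t x| ≤ B * δ :=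
      (mul_le_mul_of_nonneg_right ((le_abs_self _).trans hAi) (abs_nonneg _)).trans
        (mul_le_mul_of_nonneg_left htx hB)
    linarith
  · exfalso
    have : x ∈ frontier R := h.seg_subset i ⟨ht, g1.le, by linarith⟩
    exact this.2 hx
  · left
    refine ⟨i, ((e i).mem_tri_iff hτ).2 ⟨ht, ?_⟩⟩
    have h4 : δ = τ * (τ⁻¹ * δ) := by rw [mul_inv_cancel_left₀ hτ.ne']
    have h5 : τ * (τ⁻¹ * δ) < τ * (e i).gap ((e i).s x) := by gcongr; linarith
    linarith [(abs_le.1 htx).2]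

end EdgeSystem

/-- A Lipschitz cutoff of a set, equal to `1` at distance at least `δ` inside the set. -/
def cutoff (R : Set Plane) (δ : ℝ) (x : Plane) : ℝ := min 1 (δ⁻¹ * infDist x Rᶜ)

lemma lipschitzWith_cutoff (R : Set Plane) {δ : ℝ} (hδ : 0 < δ) :
    LipschitzWith (δ⁻¹).toNNReal (cutoff R δ) := by
  refine LipschitzWith.of_dist_le_mul fun x y => ?_
  rw [Real.coe_toNNReal _ (inv_nonneg.2 hδ.le), Real.dist_eq]
  refine (abs_min_sub_min_le_max _ _ _ _).trans ?_
  rw [sub_self, abs_zero, max_eq_right (abs_nonneg _), ← mul_sub, abs_mul,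
    abs_of_pos (inv_pos.2 hδ)]
  refine mul_le_mul_of_nonneg_left ?_ (inv_nonneg.2 hδ.le)
  simpa [Real.dist_eq] using (lipschitz_infDist_pt Rᶜ).dist_le_mul x y

lemma cutoff_mem_Icc (R : Set Plane) {δ : ℝ} (hδ : 0 < δ) (x : Plane) :
    cutoff R δ x ∈ Icc 0 1 :=
  ⟨le_min zero_le_one (mul_nonneg (inv_nonneg.2 hδ.le) infDist_nonneg), min_le_left _ _⟩

lemma continuous_divergence {Φ : Plane → Plane} (hΦ : ContDiff ℝ 1 Φ) :
    Continuous (divergence Φ) := by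
  have := hΦ.continuous_fderiv one_ne_zero
  unfold divergence
  fun_prop

lemma hasCompactSupport_divergence {Φ : Plane → Plane} (hc : HasCompactSupport Φ) :
    HasCompactSupport (divergence Φ) := by
  refine (hc.fderiv ℝ).mono fun x hx => ?_
  contrapose! hx
  simp only [Function.mem_support, not_not] at hx ⊢
  simp [divergence, hx]

lemma integral_mul_divergence {Φ : Plane → Plane} (hΦ : ContDiff ℝ 1 Φ)
    (hc : HasCompactSupport Φ) {χ : Plane → ℝ} {C : NNReal} (hχ : LipschitzWith C χ) :
    ∫ x, χ x * divergence Φ x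
      = -∫ x, ∑ i, lineDeriv ℝ χ x (EuclideanSpace.single i 1) * Φ x i := by
  have hcoord : ∀ i, ContDiff ℝ 1 fun x => Φ x i := fun i => (contDiff_euclidean.1 hΦ) i
  have hcc : ∀ i, HasCompactSupport fun x => Φ x i := fun i =>
    hc.comp_left (g := fun v : Plane => v i) rfl
  have hcont := hΦ.continuous_fderiv one_ne_zero
  have hint1 : ∀ i, Integrable fun x => χ x * fderiv ℝ Φ x (EuclideanSpace.single i 1) i := by
    intro i
    refine (hχ.continuous.mul (by fun_prop)).integrable_of_hasCompactSupport ?_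
    refine HasCompactSupport.mul_left ((hc.fderiv ℝ).mono fun x hx => ?_)
    contrapose! hx
    simp only [Function.mem_support, not_not] at hx ⊢
    simp [hx]
  have hint2 : ∀ i, Integrable fun x => lineDeriv ℝ χ x (EuclideanSpace.single i 1) * Φ x i := by
    intro i
    refine ((hcoord i).continuous.integrable_of_hasCompactSupport (hcc i)).bdd_mul
      (measurable_lineDeriv hχ.continuous).aestronglyMeasurable
      (Filter.Eventually.of_forall fun x => norm_lineDeriv_le_of_lipschitz ℝ hχ)
  rw [integral_finsetSum _ fun i _ => hint2 i]
  simp only [divergence, Finset.mul_sum]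
  rw [integral_finsetSum _ fun i _ => hint1 i, ← Finset.sum_neg_distrib]
  refine Finset.sum_congr rfl fun i _ => ?_
  obtain ⟨D, hD⟩ := (hcoord i).lipschitzWith_of_hasCompactSupport (hcc i) one_ne_zero
  rw [LipschitzWith.integral_lineDeriv_mul_eq hχ hD (hcc i), ← integral_neg]
  refine integral_congr_ae (Filter.Eventually.of_forall fun x => ?_)
  have hd : HasFDerivAt (fun x => Φ x i)
      ((EuclideanSpace.proj i : Plane →L[ℝ] ℝ).comp (fderiv ℝ Φ x)) x :=
    (EuclideanSpace.proj i : Plane →L[ℝ] ℝ).hasFDerivAt.comp x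
      (hΦ.differentiable one_ne_zero x).hasFDerivAt
  simp only [hd.hasLineDerivAt (-EuclideanSpace.single i 1) |>.lineDeriv]
  simp [mul_comm]

lemma Edge.lineDeriv_t (e : Edge) (c : ℝ) (x v : Plane) :
    lineDeriv ℝ (fun y => c * e.t y) x v = c * inner ℝ e.nor v := by
  have h : ∀ s : ℝ, c * e.t (x + s • v) = c * e.t x + s * (c * inner ℝ e.nor v) := by
    intro s
    have := e.t_sub (x + s • v) x
    rw [add_sub_cancel_left, inner_smul_right] at this
    linear_combination c * this
  have : HasLineDerivAt ℝ (fun y => c * e.t y) (c * inner ℝ e.nor v) x v := by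
    unfold HasLineDerivAt
    simp only [h]
    simpa using ((hasDerivAt_id (0 : ℝ)).mul_const (c * inner ℝ e.nor v)).const_add (c * e.t x)
  exact this.lineDeriv

namespace EdgeSystem

variable {τ : ℝ} {R : Set Plane} {ι : Type*} {e : ι → Edge}

lemma lineDeriv_cutoff_of_lt {δ : ℝ} (hδ : 0 < δ) {x : Plane} (hx : δ < infDist x Rᶜ)
    (v : Plane) : lineDeriv ℝ (cutoff R δ) x v = 0 := by
  have : cutoff R δ =ᶠ[nhds x] fun _ => 1 := by
    filter_upwards [(continuous_infDist_pt Rᶜ).continuousAt.eventually (lt_mem_nhds hx)] with y hy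
    refine min_eq_left ?_
    rw [← div_eq_inv_mul, one_le_div hδ]; exact hy.le
  rw [this.lineDeriv_eq]
  simp [lineDeriv]

lemma lineDeriv_cutoff_of_notMem (hR : IsClosed R) (δ : ℝ) {x : Plane} (hx : x ∉ R)
    (v : Plane) : lineDeriv ℝ (cutoff R δ) x v = 0 := by
  have : cutoff R δ =ᶠ[nhds x] fun _ => 0 := by
    filter_upwards [hR.isOpen_compl.mem_nhds hx] with y hy
    rw [cutoff, infDist_zero_of_mem hy, mul_zero, min_eq_right zero_le_one]
  rw [this.lineDeriv_eq]
  simp [lineDeriv]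

lemma lineDeriv_cutoff_of_mem_tri (h : EdgeSystem τ R e) (hτ : 0 < τ) {δ : ℝ} (hδ : 0 < δ)
    {i : ι} {x : Plane} (hx : x ∈ (e i).tri τ) (hxt : (e i).t x < δ) (v : Plane) :
    lineDeriv ℝ (cutoff R δ) x v = δ⁻¹ * inner ℝ (e i).nor v := by
  have : cutoff R δ =ᶠ[nhds x] fun y => δ⁻¹ * (e i).t y := by
    filter_upwards [((e i).isOpen_tri τ).mem_nhds hx,
      (e i).continuous_t.continuousAt.eventually (gt_mem_nhds hxt)] with y hy hyt
    rw [cutoff, h.infDist_eq hτ i hy]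
    refine min_eq_right ?_
    rw [← div_eq_inv_mul, div_le_one hδ]; exact hyt.le
  rw [this.lineDeriv_eq, Edge.lineDeriv_t]

lemma exists_abs_integral_cutoff_le (h : EdgeSystem τ R e) (hτ : 0 < τ) [Fintype ι]
    {Φ : Plane → Plane} (hΦ : ContDiff ℝ 1 Φ) (hc : HasCompactSupport Φ) :
    ∃ K : ℝ, ∀ δ > 0, |(∫ x, cutoff R δ x * divergence Φ x) +
      ∑ i, δ⁻¹ * ∫ x in (e i).tri τ ∩ {x | (e i).t x < δ}, inner ℝ (Φ x) (e i).nor| ≤ K * δ := by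
  obtain ⟨C, hC0, hC⟩ := h.exists_const_mem_tri_or hτ
  obtain ⟨M, hM⟩ := hc.exists_bound_of_continuous hΦ.continuous
  have hM0 : 0 ≤ M := (norm_nonneg _).trans (hM 0)
  set ω := (volume (ball (0 : Plane) 1)).toReal with hω
  refine ⟨∑ i : ι, (2 * M * (C ^ 2 * ω) + 2 * M * (C ^ 2 * ω)), fun δ hδ => ?_⟩
  have hms : ∀ i, MeasurableSet ((e i).tri τ ∩ {x | (e i).t x < δ}) := fun i =>
    (e i).measurableSet_tri.inter (isOpen_lt (e i).continuous_t continuous_const).measurableSet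
  have hΦc := hΦ.continuous
  have hlip := lipschitzWith_cutoff R hδ
  rw [integral_mul_divergence hΦ hc hlip]
  set G : Plane → ℝ := fun x =>
    ∑ i, lineDeriv ℝ (cutoff R δ) x (EuclideanSpace.single i 1) * Φ x i with hG
  have hcoord : ∀ i, Continuous fun x => Φ x i := fun i => by fun_prop
  have hcc : ∀ i, HasCompactSupport fun x => Φ x i := fun i =>
    hc.comp_left (g := fun v : Plane => v i) rfl
  have hGint : Integrable G := by
    refine integrable_finsetSum _ fun i _ => ?_
    refine ((hcoord i).integrable_of_hasCompactSupport (hcc i)).bdd_mul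
      (measurable_lineDeriv hlip.continuous).aestronglyMeasurable
      (Filter.Eventually.of_forall fun x => norm_lineDeriv_le_of_lipschitz ℝ hlip)
  set H : Plane → ℝ := fun x => ∑ i, ((e i).tri τ ∩ {x | (e i).t x < δ}).indicator
    (fun x => δ⁻¹ * inner ℝ (Φ x) (e i).nor) x with hH
  have hHi : ∀ i, Integrable (((e i).tri τ ∩ {x | (e i).t x < δ}).indicator
      (fun x => δ⁻¹ * inner ℝ (Φ x) (e i).nor)) := fun i =>
    (((e i).integrableOn_tri_of_continuous hτ (by fun_prop)).mono_set
      inter_subset_left).integrable_indicator (hms i)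
  have hHint : Integrable H := integrable_finsetSum _ fun i _ => hHi i
  have hHeq : ∫ x, H x = ∑ i, δ⁻¹ * ∫ x in (e i).tri τ ∩ {x | (e i).t x < δ},
      inner ℝ (Φ x) (e i).nor := by
    rw [hH, integral_finsetSum _ fun i _ => hHi i]
    refine Finset.sum_congr rfl fun i _ => ?_
    rw [integral_indicator (hms i), integral_const_mul]
  rw [← hHeq, neg_add_eq_sub, ← integral_sub hHint hGint, ← Real.norm_eq_abs]
  set b : Plane → ℝ := fun x => ∑ i,
    ((closedBall (e i).base (C * δ)).indicator (fun _ => δ⁻¹ * (2 * M)) x +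
      (closedBall ((e i).pt (e i).len 0) (C * δ)).indicator (fun _ => δ⁻¹ * (2 * M)) x) with hb
  have hBi : ∀ p : Plane, Integrable
      ((closedBall p (C * δ)).indicator (fun _ => δ⁻¹ * (2 * M)) : Plane → ℝ) := fun p =>
    (integrableOn_const measure_closedBall_lt_top.ne).integrable_indicator
      isClosed_closedBall.measurableSet
  have hBv : ∀ p : Plane, ∫ x, (closedBall p (C * δ)).indicator (fun _ => δ⁻¹ * (2 * M)) x
      = 2 * M * (C ^ 2 * ω) * δ := by
    intro p
    rw [integral_indicator isClosed_closedBall.measurableSet, setIntegral_const, Measure.real,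
      Measure.addHaar_closedBall _ _ (by positivity), ENNReal.toReal_mul,
      ENNReal.toReal_ofReal (by positivity), ← hω, finrank_euclideanSpace_fin, smul_eq_mul]
    field_simp
  have hbint : ∫ x, b x = (∑ i : ι, (2 * M * (C ^ 2 * ω) + 2 * M * (C ^ 2 * ω))) * δ := by
    have hBs : ∀ i ∈ (Finset.univ : Finset ι), Integrable fun x =>
        (closedBall (e i).base (C * δ)).indicator (fun _ => δ⁻¹ * (2 * M)) x +
        (closedBall ((e i).pt (e i).len 0) (C * δ)).indicator (fun _ => δ⁻¹ * (2 * M)) x :=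
      fun i _ => (hBi _).add (hBi _)
    rw [hb, integral_finsetSum _ hBs, Finset.sum_mul]
    refine Finset.sum_congr rfl fun i _ => ?_
    rw [integral_add (hBi _) (hBi _), hBv, hBv, add_mul]
  rw [← hbint]
  have hind0 : ∀ p x : Plane,
      0 ≤ (closedBall p (C * δ)).indicator (fun _ => δ⁻¹ * (2 * M)) x := fun p x =>
    indicator_nonneg (fun _ _ => by positivity) x
  have hb0 : ∀ x, 0 ≤ b x := fun x =>
    Finset.sum_nonneg fun i _ => add_nonneg (hind0 _ _) (hind0 _ _)
  refine norm_integral_le_of_norm_le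
    (integrable_finsetSum _ fun i _ => (hBi _).add (hBi _)) ?_
  have hae1 : ∀ᵐ x, x ∉ frontier R := by
    rw [ae_iff]; simpa using h.volume_frontier
  have hae2 : ∀ᵐ x, ∀ i, (e i).t x ≠ δ := by
    rw [ae_all_iff]; intro i
    rw [ae_iff]; simpa using (e i).measure_setOf_t_eq δ
  filter_upwards [hae1, hae2] with x hx1 hx2
  by_cases hT : ∃ i, x ∈ (e i).tri τ
  · obtain ⟨k, hk⟩ := hT
    have hHx : H x = ((e k).tri τ ∩ {x | (e k).t x < δ}).indicator
        (fun x => δ⁻¹ * inner ℝ (Φ x) (e k).nor) x := by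
      refine Finset.sum_eq_single k (fun j _ hj => indicator_of_notMem ?_ _) (by simp)
      exact fun hxj => Set.disjoint_left.1 (h.disjoint hj) hxj.1 hk
    rcases lt_or_gt_of_ne (hx2 k) with hlt | hgt
    · have : H x = G x := by
        rw [hHx, indicator_of_mem (mem_inter hk hlt), hG]
        simp only [h.lineDeriv_cutoff_of_mem_tri hτ hδ hk hlt]
        rw [PiLp.inner_apply, Finset.mul_sum]
        refine Finset.sum_congr rfl fun i _ => ?_
        simp [EuclideanSpace.inner_single_right]
        ring
      rw [this, sub_self, norm_zero]; exact hb0 x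
    · have h1 : H x = 0 := by
        rw [hHx]; exact indicator_of_notMem (fun hh => (lt_asymm hh.2 hgt)) _
      have h2 : G x = 0 := by
        refine Finset.sum_eq_zero fun i _ => ?_
        rw [lineDeriv_cutoff_of_lt hδ (by rwa [h.infDist_eq hτ k hk]), zero_mul]
      rw [h1, h2, sub_self, norm_zero]; exact hb0 x
  have h1 : H x = 0 :=
    Finset.sum_eq_zero fun i _ => indicator_of_notMem (fun hh => hT ⟨i, hh.1⟩) _
  rw [h1, zero_sub, norm_neg]
  by_cases hxR : x ∈ R
  · have hxi : x ∈ interior R := by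
      by_contra hni
      exact hx1 ⟨subset_closure hxR, hni⟩
    by_cases hxδ : infDist x Rᶜ ≤ δ
    · obtain ⟨k, hk⟩ := (hC δ hδ x hxi hxδ).resolve_left hT
      have hGle : ‖G x‖ ≤ δ⁻¹ * (2 * M) := by
        refine (norm_sum_le _ _).trans ?_
        rw [Fin.sum_univ_two]
        have : ∀ i, ‖lineDeriv ℝ (cutoff R δ) x (EuclideanSpace.single i 1) * Φ x i‖ ≤ δ⁻¹ * M := by
          intro i
          rw [norm_mul]
          have h1 := norm_lineDeriv_le_of_lipschitz ℝ hlip (x₀ := x)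
            (v := EuclideanSpace.single i 1)
          rw [Real.coe_toNNReal _ (inv_nonneg.2 hδ.le), PiLp.norm_single, norm_one,
            mul_one] at h1
          exact mul_le_mul h1 ((PiLp.norm_apply_le (Φ x) i).trans (hM x)) (norm_nonneg _)
            (inv_nonneg.2 hδ.le)
        linarith [this 0, this 1]
      refine hGle.trans ?_
      have hle := Finset.single_le_sum (f := fun i =>
        (closedBall (e i).base (C * δ)).indicator (fun _ => δ⁻¹ * (2 * M)) x +
          (closedBall ((e i).pt (e i).len 0) (C * δ)).indicator (fun _ => δ⁻¹ * (2 * M)) x)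
        (fun i _ => add_nonneg (hind0 _ _) (hind0 _ _)) (Finset.mem_univ k)
      refine le_trans ?_ hle
      rcases hk with hk | hk
      · simp only [indicator_of_mem hk]
        linarith [hind0 ((e k).pt (e k).len 0) x]
      · simp only [indicator_of_mem hk]
        linarith [hind0 (e k).base x]
    · have h2 : G x = 0 := by
        refine Finset.sum_eq_zero fun i _ => ?_
        rw [lineDeriv_cutoff_of_lt hδ (not_le.1 hxδ), zero_mul]
      rw [h2, norm_zero]; exact hb0 x
  · have h2 : G x = 0 := by
      refine Finset.sum_eq_zero fun i _ => ?_
      rw [lineDeriv_cutoff_of_notMem h.isCompact.isClosed δ hxR, zero_mul]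
    rw [h2, norm_zero]; exact hb0 x

/-- The divergence theorem for a set with an edge system. -/
lemma integral_divergence (h : EdgeSystem τ R e) (hτ : 0 < τ) [Fintype ι]
    {Φ : Plane → Plane} (hΦ : ContDiff ℝ 1 Φ) (hc : HasCompactSupport Φ) :
    ∫ x in R, divergence Φ x
      = -∑ i, ∫ a in Ioo 0 (e i).len, inner ℝ (Φ ((e i).pt a 0)) (e i).nor := by
  obtain ⟨K, hK⟩ := h.exists_abs_integral_cutoff_le hτ hΦ hc
  have hdiv := (continuous_divergence hΦ).integrable_of_hasCompactSupport (μ := volume)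
    (hasCompactSupport_divergence hc)
  have hΦc := hΦ.continuous
  have hX : Filter.Tendsto (fun δ : ℝ => ∫ x, cutoff R δ x * divergence Φ x)
      (nhdsWithin 0 (Ioi 0)) (nhds (∫ x in R, divergence Φ x)) := by
    rw [← integral_indicator h.isCompact.isClosed.measurableSet]
    apply tendsto_integral_filter_of_dominated_convergence (fun x => ‖divergence Φ x‖)
    · filter_upwards [self_mem_nhdsWithin] with δ hδ
      exact ((lipschitzWith_cutoff R hδ).continuous.mul
        (continuous_divergence hΦ)).aestronglyMeasurable
    · filter_upwards [self_mem_nhdsWithin] with δ hδ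
      refine Filter.Eventually.of_forall fun x => ?_
      have := cutoff_mem_Icc R (show 0 < δ from hδ) x
      rw [norm_mul, Real.norm_of_nonneg this.1]
      exact mul_le_of_le_one_left (norm_nonneg _) this.2
    · exact hdiv.norm
    · have hae1 : ∀ᵐ x, x ∉ frontier R := by
        rw [ae_iff]; simpa using h.volume_frontier
      filter_upwards [hae1] with x hx
      refine tendsto_const_nhds.congr' ?_
      by_cases hxR : x ∈ R
      · have hpos : 0 < infDist x Rᶜ := by
          rw [← infDist_closure, ← isClosed_closure.notMem_iff_infDist_pos
            h.nonempty_compl.closure, closure_compl]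
          exact fun hh => hx ⟨subset_closure hxR, hh⟩
        filter_upwards [Ioo_mem_nhdsGT hpos] with δ hδ
        rw [indicator_of_mem hxR, cutoff, min_eq_left, one_mul]
        rw [← div_eq_inv_mul, one_le_div hδ.1]; exact hδ.2.le
      · refine Filter.Eventually.of_forall fun δ => ?_
        rw [indicator_of_notMem hxR]
        simp [cutoff, infDist_zero_of_mem (show x ∈ Rᶜ from hxR)]
  have hY := tendsto_finsetSum (Finset.univ : Finset ι) fun i _ =>
    (e i).tendsto_integral_strip hτ (F := fun x => inner ℝ (Φ x) (e i).nor) (by fun_prop)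
  have hXY := hX.add hY
  have h0 : Filter.Tendsto (fun δ : ℝ => K * δ) (nhdsWithin 0 (Ioi 0)) (nhds 0) := by
    have : Filter.Tendsto (fun δ : ℝ => K * δ) (nhds 0) (nhds (K * 0)) :=
      (continuous_const.mul continuous_id).tendsto 0
    rw [mul_zero] at this
    exact this.mono_left nhdsWithin_le_nhds
  have hz := tendsto_nhds_unique hXY (squeeze_zero_norm' (by
    filter_upwards [self_mem_nhdsWithin] with δ hδ
    rw [Real.norm_eq_abs]
    exact hK δ hδ) h0)
  linarith

end EdgeSystem

open scoped Convolution in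
/-- Mollifying a bounded compactly supported field with integrable weak divergence gives a smooth
test field whose divergence is the mollified weak divergence. -/
lemma exists_mollified_field {Ω K : Set Plane} {r : ℝ} (hK : IsCompact K)
    (hKΩ : cthickening r K ⊆ interior Ω) {ψ : Plane → Plane} (hψ : Measurable ψ)
    (hψ1 : ∀ x, ‖ψ x‖ ≤ 1) (hψK : ∀ x ∉ K, ψ x = 0) {D : Plane → ℝ}
    (hweak : ∀ u : Plane → ℝ, ContDiff ℝ 1 u → HasCompactSupport u →
      ∫ x, fderiv ℝ u x (ψ x) = -∫ x, D x * u x)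
    {ρ : Plane → ℝ} (hρ : ContDiff ℝ 1 ρ) (hρr : Function.support ρ ⊆ ball 0 r)
    (hρ0 : ∀ x, 0 ≤ ρ x) (hρ1 : ∫ x, ρ x = 1) :
    ∃ φ : Plane → Plane, (ContDiff ℝ 1 φ ∧ HasCompactSupport φ ∧ tsupport φ ⊆ interior Ω ∧
      ∀ x, ‖φ x‖ ≤ 1) ∧ ∀ x, divergence φ x = ∫ y, D y * ρ (x - y) := by
  have hρc : HasCompactSupport ρ :=
    HasCompactSupport.of_support_subset_isCompact (isCompact_closedBall 0 r)
      (hρr.trans ball_subset_closedBall)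
  have hψint : Integrable ψ := by
    have : ψ = K.indicator ψ := by
      funext x
      by_cases hx : x ∈ K
      · rw [indicator_of_mem hx]
      · rw [indicator_of_notMem hx, hψK x hx]
    rw [this, integrable_indicator_iff hK.measurableSet]
    exact Measure.integrableOn_of_bounded hK.measure_lt_top.ne hψ.aestronglyMeasurable
      (M := 1) (Filter.Eventually.of_forall hψ1)
  have hρint : Integrable ρ := hρ.continuous.integrable_of_hasCompactSupport hρc
  set L : ℝ →L[ℝ] Plane →L[ℝ] Plane := ContinuousLinearMap.lsmul ℝ ℝ
  set φ : Plane → Plane := ρ ⋆[L, volume] ψ with hφ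
  have hφx : ∀ x, φ x = ∫ y, ρ y • ψ (x - y) := fun x => rfl
  have hsupp : Function.support φ ⊆ cthickening r K := by
    intro x hx
    by_contra hxK
    refine hx ?_
    rw [hφx]
    refine integral_eq_zero_of_ae (Filter.Eventually.of_forall fun y => ?_)
    by_cases hy : y ∈ Function.support ρ
    · have hyr := hρr hy
      rw [mem_ball_zero_iff] at hyr
      have : x - y ∉ K := fun h => hxK (mem_cthickening_of_dist_le x (x - y) r K h (by
        rw [dist_eq_norm]; simpa using hyr.le))
      simp [hψK _ this]
    · simp [Function.notMem_support.1 hy]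
  have hcK : IsCompact (cthickening r K) := hK.cthickening
  refine ⟨φ, ⟨?_, ?_, ?_, ?_⟩, ?_⟩
  · exact hρc.contDiff_convolution_left (n := 1) L hρ hψint.locallyIntegrable
  · exact HasCompactSupport.of_support_subset_isCompact hcK hsupp
  · exact (closure_minimal hsupp hcK.isClosed).trans hKΩ
  · intro x
    rw [hφx, ← hρ1]
    refine norm_integral_le_of_norm_le hρint (Filter.Eventually.of_forall fun y => ?_)
    rw [norm_smul, Real.norm_of_nonneg (hρ0 y)]
    exact mul_le_of_le_one_right (hρ0 y) (hψ1 _)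
  · intro x
    have hd := hρc.hasFDerivAt_convolution_left L hρ hψint.locallyIntegrable x
    set ℓ : (Plane →L[ℝ] Plane) →L[ℝ] ℝ := ∑ i : Fin 2,
      (EuclideanSpace.proj i : Plane →L[ℝ] ℝ).comp
        (ContinuousLinearMap.apply ℝ Plane (EuclideanSpace.single i (1 : ℝ))) with hℓ
    have hdiv : divergence φ x = ℓ (fderiv ℝ φ x) := by
      simp [divergence, hℓ]
    have hint := (hρc.fderiv ℝ).convolutionExists_left (L.precompL Plane)
      (hρ.continuous_fderiv one_ne_zero) hψint.locallyIntegrable (μ := volume) x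
    have key : ∀ y, ℓ (L.precompL Plane (fderiv ℝ ρ y) (ψ (x - y)))
        = fderiv ℝ ρ y (ψ (x - y)) := by
      intro y
      have hv : ψ (x - y) = ∑ i, ψ (x - y) i • EuclideanSpace.single i (1 : ℝ) := by
        have := (EuclideanSpace.basisFun (Fin 2) ℝ).sum_repr (ψ (x - y))
        simpa using this.symm
      conv_rhs => rw [hv]
      rw [hℓ, map_sum]
      simp [ContinuousLinearMap.precompL_apply, L, mul_comm]
    rw [hdiv, hd.fderiv, convolution_def, ← ContinuousLinearMap.integral_comp_comm _ hint]
    simp only [key]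
    have hu : ContDiff ℝ 1 fun y => ρ (x - y) := hρ.comp (contDiff_const.sub contDiff_id)
    have huc : HasCompactSupport fun y => ρ (x - y) :=
      hρc.comp_homeomorph (Homeomorph.subLeft x)
    have hw := hweak _ hu huc
    have hdu : ∀ y v, fderiv ℝ (fun y => ρ (x - y)) y v = -fderiv ℝ ρ (x - y) v := by
      intro y v
      have h1 : HasFDerivAt (fun y : Plane => x - y) (-ContinuousLinearMap.id ℝ Plane) y :=
        (hasFDerivAt_id y).const_sub x
      have := (hρ.differentiable one_ne_zero (x - y)).hasFDerivAt.comp y h1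
      have h2 := this.fderiv
      simp only [Function.comp_def] at h2
      rw [h2]; simp
    simp only [hdu] at hw
    rw [integral_neg, neg_inj] at hw
    rw [← hw, ← integral_sub_left_eq_self (fun y => fderiv ℝ ρ y (ψ (x - y))) volume x]
    simp

/-- Bounded compactly supported fields with integrable weak divergence are admissible in the
definition of the total variation. -/
lemma ofReal_integral_mul_le_bvSeminorm {Ω K : Set Plane} (hΩ : IsCompact Ω) {g : Plane → ℝ}
    (hg : Measurable g) {C : ℝ} (hgC : ∀ x, |g x| ≤ C) (hK : IsCompact K)
    (hKΩ : K ⊆ interior Ω) {ψ : Plane → Plane} (hψ : Measurable ψ)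
    (hψ1 : ∀ x, ‖ψ x‖ ≤ 1) (hψK : ∀ x ∉ K, ψ x = 0) {D : Plane → ℝ} (hD : Integrable D)
    (hweak : ∀ u : Plane → ℝ, ContDiff ℝ 1 u → HasCompactSupport u →
      ∫ x, fderiv ℝ u x (ψ x) = -∫ x, D x * u x) :
    ENNReal.ofReal (∫ x in Ω, g x * D x) ≤ bvSeminorm Ω g := by
  obtain ⟨r, hr, hrK⟩ := hK.exists_cthickening_subset_open isOpen_interior hKΩ
  set G : Plane → ℝ := Ω.indicator g with hG
  have hGm : Measurable G := hg.indicator hΩ.measurableSet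
  have hC0 : 0 ≤ C := (abs_nonneg _).trans (hgC 0)
  have hGC : ∀ x, ‖G x‖ ≤ C := fun x => (norm_indicator_le_norm_self g x).trans (hgC x)
  have hGint : Integrable G := by
    rw [hG, integrable_indicator_iff hΩ.measurableSet]
    exact Measure.integrableOn_of_bounded hΩ.measure_lt_top.ne hg.aestronglyMeasurable
      (M := C) (Filter.Eventually.of_forall hgC)
  have hto : ∀ F : Plane → ℝ, ∫ x in Ω, g x * F x = ∫ x, G x * F x := by
    intro F
    rw [← integral_indicator hΩ.measurableSet]
    congr 1; funext x
    rw [hG, indicator_mul_left]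
  let b : ℕ → ContDiffBump (0 : Plane) := fun n =>
    ⟨r / (n + 1) / 2, r / (n + 1), by positivity, half_lt_self (by positivity)⟩
  have hb : Filter.Tendsto (fun n => (b n).rOut) Filter.atTop (nhds 0) :=
    tendsto_const_div_atTop_nhds_zero_nat r |>.comp (Filter.tendsto_add_atTop_nat 1) |>.congr
      fun n => by simp [b]
  have hae := ContDiffBump.ae_convolution_tendsto_right_of_locallyIntegrable (K := 2)
    (μ := volume) hb (Filter.Eventually.of_forall fun n => by simp only [b]; linarith)
    hGint.locallyIntegrable
  have hconvC : ∀ n y, ‖∫ x, (b n).normed volume x * G (y - x)‖ ≤ C := by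
    intro n y
    have h1 : ∫ x, (b n).normed volume x * C = C := by
      rw [integral_mul_const, ContDiffBump.integral_normed, one_mul]
    refine (norm_integral_le_of_norm_le ((b n).integrable_normed.mul_const C)
      (Filter.Eventually.of_forall fun x => ?_)).trans h1.le
    rw [norm_mul, Real.norm_of_nonneg ((b n).nonneg_normed x)]
    exact mul_le_mul_of_nonneg_left (hGC _) ((b n).nonneg_normed x)
  have hlim : Filter.Tendsto
      (fun n => ∫ y, (∫ x, (b n).normed volume x * G (y - x)) * D y) Filter.atTop
      (nhds (∫ y, G y * D y)) := by
    apply tendsto_integral_of_dominated_convergence (fun y => C * ‖D y‖)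
    · intro n
      refine AEStronglyMeasurable.mul ?_ hD.aestronglyMeasurable
      have hm : Measurable fun p : Plane × Plane => (b n).normed volume p.2 * G (p.1 - p.2) :=
        ((b n).continuous_normed.measurable.comp measurable_snd).mul
          (hGm.comp (measurable_fst.sub measurable_snd))
      exact (hm.stronglyMeasurable.integral_prod_right').aestronglyMeasurable
    · exact hD.norm.const_mul C
    · intro n
      refine Filter.Eventually.of_forall fun y => ?_
      rw [norm_mul]
      exact mul_le_mul_of_nonneg_right (hconvC n y) (norm_nonneg _)
    · filter_upwards [hae] with y hy
      exact Filter.Tendsto.mul_const (D y) hy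
  rw [hto]
  refine le_of_tendsto' (ENNReal.continuous_ofReal.continuousAt.tendsto.comp hlim) fun n => ?_
  have hrn : (b n).rOut ≤ r := div_le_self hr.le (by simp)
  obtain ⟨φ, hφ, hdiv⟩ := exists_mollified_field hK
    ((cthickening_mono hrn K).trans hrK) hψ hψ1 hψK hweak
    (ρ := (b n).normed volume) (b n).contDiff_normed (b n).support_normed_eq.subset
    (b n).nonneg_normed (b n).integral_normed
  have heq : ∫ y, (∫ x, (b n).normed volume x * G (y - x)) * D y
      = ∫ x in Ω, g x * divergence φ x := by
    rw [hto]
    simp only [hdiv]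
    have h1 : ∀ y, ∫ x, (b n).normed volume x * G (y - x)
        = ∫ x, (b n).normed volume (x - y) * G x := by
      intro y
      rw [← integral_sub_left_eq_self (fun x => (b n).normed volume x * G (y - x)) volume y]
      congr 1; funext x
      have h2 : y - (y - x) = x := by abel
      have h3 : y - x = -(x - y) := by abel
      rw [h2, h3, ContDiffBump.normed_neg]
    simp only [h1, ← integral_mul_const, ← integral_const_mul]
    have hbd : ∃ M, ∀ x, ‖(b n).normed volume x‖ ≤ M :=
      (b n).hasCompactSupport_normed.exists_bound_of_continuous (b n).continuous_normed
    obtain ⟨M, hM⟩ := hbd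
    rw [integral_integral_swap]
    · congr 1; funext x; congr 1; funext y; ring
    · have hp := (hD.mul_prod hGint).bdd_mul (c := M)
        (f := fun p : Plane × Plane => (b n).normed volume (p.2 - p.1))
        (((b n).continuous_normed.comp (continuous_snd.sub continuous_fst)).aestronglyMeasurable)
        (Filter.Eventually.of_forall fun p => hM _)
      refine hp.congr (Filter.Eventually.of_forall fun p => ?_)
      simp only [Function.uncurry]; ring
  simp only [Function.comp]
  rw [heq]
  exact le_iSup₂_of_le φ hφ le_rfl

/-- A partition of `Ω` into finitely many sets with edge systems and disjoint interiors. -/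
structure EdgePartition (τ : ℝ) (Ω : Set Plane) {I : Type*} (R : I → Set Plane) {ι : I → Type*}
    (e : (Σ i, ι i) → Edge) : Prop where
  edgeSystem : ∀ i, EdgeSystem τ (R i) fun k => e ⟨i, k⟩
  disjoint_interior : ∀ i j, i ≠ j → interior (R i) ∩ interior (R j) = ∅
  iUnion_eq : ⋃ i, R i = Ω

/-- The normal component of a field along an edge. -/
def Edge.flux (e : Edge) (φ : Plane → Plane) (a : ℝ) : ℝ := inner ℝ (φ (e.pt a 0)) e.nor

lemma Edge.continuous_flux (e : Edge) {φ : Plane → Plane} (hφ : Continuous φ) :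
    Continuous (e.flux φ) := by
  have : Continuous fun a => e.pt a 0 := by unfold Edge.pt; fun_prop
  have h2 := hφ.comp this
  simp only [Function.comp_def] at h2
  unfold Edge.flux
  fun_prop

lemma Edge.abs_flux_le (e : Edge) {φ : Plane → Plane} (hφ : ∀ x, ‖φ x‖ ≤ 1) (a : ℝ) :
    |e.flux φ a| ≤ 1 := by
  refine (abs_real_inner_le_norm _ _).trans ?_
  rw [e.norm_nor, mul_one]; exact hφ _

lemma Edge.integral_tri_weight_mul (e : Edge) {τ : ℝ} (hτ : 0 < τ) {g : ℝ → ℝ}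
    (hg : Continuous g) :
    ∫ x in e.tri τ, e.weight τ x * g (e.s x) = ∫ a in Ioo 0 e.len, g a := by
  have := e.integral_tri_hat_mul hτ (u := fun _ => (1 : ℝ)) contDiff_const hg
  simp only [fderiv_const_apply, zero_apply, mul_zero, integral_zero,
    mul_one] at this
  linarith

lemma integral_divergence_eq_zero {Φ : Plane → Plane} (hΦ : ContDiff ℝ 1 Φ)
    (hc : HasCompactSupport Φ) : ∫ x, divergence Φ x = 0 := by
  have := integral_mul_divergence hΦ hc (LipschitzWith.const (1 : ℝ))
  simpa [lineDeriv] using this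

namespace EdgePartition

variable {τ : ℝ} {Ω : Set Plane} {I : Type*} {R : I → Set Plane} {ι : I → Type*}
  {e : (Σ i, ι i) → Edge}

lemma aedisjoint (h : EdgePartition τ Ω R e) [∀ i, Finite (ι i)] :
    Pairwise (Function.onFun (AEDisjoint volume) R) := by
  intro i j hij
  refine measure_mono_null (t := frontier (R i) ∪ frontier (R j)) (fun x hx => ?_)
    (measure_union_null (h.edgeSystem i).volume_frontier (h.edgeSystem j).volume_frontier)
  by_contra hn
  rw [mem_union, not_or] at hn
  have h1 : x ∈ interior (R i) := by
    by_contra h1; exact hn.1 ⟨subset_closure hx.1, h1⟩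
  have h2 : x ∈ interior (R j) := by
    by_contra h2; exact hn.2 ⟨subset_closure hx.2, h2⟩
  have := h.disjoint_interior i j hij
  exact (this ▸ mem_inter h1 h2 : x ∈ (∅ : Set Plane))

lemma measurableSet (h : EdgePartition τ Ω R e) (i : I) : MeasurableSet (R i) :=
  (h.edgeSystem i).isCompact.isClosed.measurableSet

lemma subset (h : EdgePartition τ Ω R e) (i : I) : R i ⊆ Ω := by
  rw [← h.iUnion_eq]; exact subset_iUnion R i

lemma tri_subset (h : EdgePartition τ Ω R e) (k : Σ i, ι i) : (e k).tri τ ⊆ interior (R k.1) :=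
  (h.edgeSystem k.1).tri_subset k.2

lemma disjoint_tri (h : EdgePartition τ Ω R e) :
    Pairwise fun k l => Disjoint ((e k).tri τ) ((e l).tri τ) := by
  rintro ⟨i, k⟩ ⟨j, l⟩ hkl
  by_cases hij : i = j
  · subst hij
    exact (h.edgeSystem i).disjoint fun hh => hkl (by rw [hh])
  · refine Disjoint.mono (h.tri_subset ⟨i, k⟩) (h.tri_subset ⟨j, l⟩) ?_
    exact disjoint_iff_inter_eq_empty.2 (h.disjoint_interior i j hij)

lemma measurable_sum_indicator [Fintype I] (h : EdgePartition τ Ω R e) (c : I → ℝ) :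
    Measurable fun x => ∑ i, (R i).indicator (fun _ => c i) x :=
  Finset.measurable_sum _ fun i _ => measurable_const.indicator (h.measurableSet i)

lemma abs_sum_indicator_le [Fintype I] (c : I → ℝ) (x : Plane) :
    |∑ i, (R i).indicator (fun _ => c i) x| ≤ ∑ i, |c i| := by
  refine (Finset.abs_sum_le_sum_abs _ _).trans (Finset.sum_le_sum fun i _ => ?_)
  by_cases hx : x ∈ R i
  · rw [indicator_of_mem hx]
  · rw [indicator_of_notMem hx, abs_zero]; exact abs_nonneg _

variable [Fintype I] [∀ i, Fintype (ι i)]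

lemma sum_integral (h : EdgePartition τ Ω R e) {F : Plane → ℝ} (hF : IntegrableOn F Ω) :
    ∑ i, ∫ x in R i, F x = ∫ x in Ω, F x := by
  rw [← h.iUnion_eq, integral_iUnion_ae (fun i => (h.measurableSet i).nullMeasurableSet)
    h.aedisjoint (by rwa [h.iUnion_eq]), tsum_fintype]

lemma sum_indicator_eq (h : EdgePartition τ Ω R e) {E : Type*} [AddCommMonoid E]
    {F : (Σ i, ι i) → Plane → E} {k : Σ i, ι i} {x : Plane} (hx : x ∈ (e k).tri τ) :
    ∑ l, ((e l).tri τ).indicator (F l) x = F k x := by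
  rw [Finset.sum_eq_single k, indicator_of_mem hx]
  · exact fun l _ hl => indicator_of_notMem
      (fun hxl => Set.disjoint_left.1 (h.disjoint_tri hl) hxl hx) _
  · simp

/-- The field supported in the triangles of a partition which interpolates the normal traces
of a given field. -/
def field (τ : ℝ) (e : (Σ i, ι i) → Edge) (φ : Plane → Plane) (x : Plane) : Plane :=
  ∑ k, ((e k).tri τ).indicator (fun x => ((e k).hat τ x * (e k).flux φ ((e k).s x)) • (e k).nor) x

/-- The weak divergence of `EdgePartition.field`. -/
def fieldDiv (τ : ℝ) (e : (Σ i, ι i) → Edge) (φ : Plane → Plane) (x : Plane) : ℝ :=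
  -∑ k, ((e k).tri τ).indicator (fun x => (e k).weight τ x * (e k).flux φ ((e k).s x)) x

lemma measurable_field {φ : Plane → Plane} (hφ : Continuous φ) : Measurable (field τ e φ) := by
  refine Finset.measurable_sum _ fun k _ => Measurable.indicator ?_ (e k).measurableSet_tri
  exact (((e k).measurable_hat τ).mul
    (((e k).continuous_flux hφ).comp (e k).continuous_s).measurable).smul_const _

lemma norm_field_le (h : EdgePartition τ Ω R e) (hτ : 0 < τ) {φ : Plane → Plane}
    (hφ : ∀ x, ‖φ x‖ ≤ 1) (x : Plane) : ‖field τ e φ x‖ ≤ 1 := by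
  by_cases hx : ∃ k, x ∈ (e k).tri τ
  · obtain ⟨k, hk⟩ := hx
    rw [field, h.sum_indicator_eq hk, norm_smul, (e k).norm_nor, mul_one, norm_mul]
    have h1 := (e k).hat_mem_Icc hτ hk
    refine mul_le_one₀ ?_ (norm_nonneg _) ((e k).abs_flux_le hφ _)
    rw [Real.norm_of_nonneg h1.1]; exact h1.2
  · push Not at hx
    rw [field, Finset.sum_eq_zero fun k _ => indicator_of_notMem (hx k) _, norm_zero]
    exact zero_le_one

lemma abs_fieldDiv_le (hτ : 0 < τ) {φ : Plane → Plane} (hφ : ∀ x, ‖φ x‖ ≤ 1) (x : Plane) :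
    |fieldDiv τ e φ x| ≤ ∑ k, ((e k).tri τ).indicator ((e k).weight τ) x := by
  rw [fieldDiv, abs_neg]
  refine (Finset.abs_sum_le_sum_abs _ _).trans (Finset.sum_le_sum fun k _ => ?_)
  by_cases hx : x ∈ (e k).tri τ
  · rw [indicator_of_mem hx, indicator_of_mem hx, abs_mul, abs_of_pos ((e k).weight_pos hτ hx)]
    exact mul_le_of_le_one_right ((e k).weight_pos hτ hx).le ((e k).abs_flux_le hφ _)
  · rw [indicator_of_notMem hx, indicator_of_notMem hx, abs_zero]

lemma integrable_fieldDiv (hτ : 0 < τ) {φ : Plane → Plane} (hφ : Continuous φ) :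
    Integrable (fieldDiv τ e φ) := by
  refine (integrable_finsetSum _ fun k _ => ?_).neg
  rw [integrable_indicator_iff (e k).measurableSet_tri]
  exact (e k).integrableOn_weight_mul hτ (((e k).continuous_flux hφ).comp (e k).continuous_s)

lemma exists_compact_field_eq_zero (h : EdgePartition τ Ω R e) (hΩ : IsCompact Ω)
    {φ : Plane → Plane} (hφΩ : tsupport φ ⊆ interior Ω) :
    ∃ K, IsCompact K ∧ K ⊆ interior Ω ∧ ∀ x ∉ K, field τ e φ x = 0 := by
  set K : (Σ i, ι i) → Set Plane := fun k => {x | 0 ≤ (e k).t x ∧ (e k).t x ≤ τ * (e k).s x ∧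
    (e k).t x ≤ τ * ((e k).len - (e k).s x) ∧ (e k).pt ((e k).s x) 0 ∈ tsupport φ} with hKdef
  have hKΩ : ∀ k, K k ⊆ interior Ω := by
    rintro k x ⟨h1, h2, h3, h4⟩
    rcases h1.eq_or_lt with h0 | h0
    · rw [h0, Edge.pt_s_t] at h4
      exact hφΩ h4
    · exact interior_mono (h.subset k.1) (interior_maximal
        ((h.edgeSystem k.1).ball_subset k.2 x h1 h2 h3) isOpen_ball (mem_ball_self h0))
  have hKc : ∀ k, IsClosed (K k) := by
    intro k
    have hs := (e k).continuous_s
    have ht := (e k).continuous_t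
    have hp : Continuous fun x => (e k).pt ((e k).s x) 0 := by unfold Edge.pt; fun_prop
    exact (isClosed_le continuous_const ht).inter
      ((isClosed_le ht (continuous_const.mul hs)).inter
        ((isClosed_le ht (continuous_const.mul (continuous_const.sub hs))).inter
          ((isClosed_tsupport φ).preimage hp)))
  refine ⟨⋃ k, K k, ?_, iUnion_subset hKΩ, fun x hx => ?_⟩
  · exact hΩ.of_isClosed_subset (isClosed_iUnion_of_finite hKc)
      ((iUnion_subset hKΩ).trans interior_subset)
  · refine Finset.sum_eq_zero fun k _ => ?_
    by_cases hxk : x ∈ (e k).tri τ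
    · rw [indicator_of_mem hxk]
      have : (e k).pt ((e k).s x) 0 ∉ tsupport φ := fun hh =>
        hx (mem_iUnion.2 ⟨k, hxk.1.le, hxk.2.1.le, hxk.2.2.le, hh⟩)
      rw [Edge.flux, image_eq_zero_of_notMem_tsupport this, inner_zero_left, mul_zero, zero_smul]
    · rw [indicator_of_notMem hxk]

lemma sum_integral_flux (h : EdgePartition τ Ω R e) (hτ : 0 < τ) {Φ : Plane → Plane}
    (hΦ : ContDiff ℝ 1 Φ) (hc : HasCompactSupport Φ) (hΦΩ : tsupport Φ ⊆ interior Ω) :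
    ∑ k, ∫ a in Ioo 0 (e k).len, (e k).flux Φ a = 0 := by
  have h1 : ∀ i, ∑ k, ∫ a in Ioo 0 (e ⟨i, k⟩).len, (e ⟨i, k⟩).flux Φ a
      = -∫ x in R i, divergence Φ x := fun i => by
    rw [(h.edgeSystem i).integral_divergence hτ hΦ hc, neg_neg]; rfl
  have hint := (continuous_divergence hΦ).integrable_of_hasCompactSupport (μ := volume)
    (hasCompactSupport_divergence hc)
  rw [Fintype.sum_sigma]
  simp only [h1]
  rw [Finset.sum_neg_distrib, h.sum_integral hint.integrableOn,
    setIntegral_eq_integral_of_forall_compl_eq_zero, integral_divergence_eq_zero hΦ hc, neg_zero]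
  intro x hx
  have : fderiv ℝ Φ x = 0 := by
    by_contra hne
    exact hx (interior_subset (hΦΩ (support_fderiv_subset ℝ hne)))
  simp [divergence, this]

lemma integral_fderiv_field (h : EdgePartition τ Ω R e) (hτ : 0 < τ) {φ : Plane → Plane}
    (hφ : ContDiff ℝ 1 φ) (hc : HasCompactSupport φ) (hφΩ : tsupport φ ⊆ interior Ω)
    {u : Plane → ℝ} (hu : ContDiff ℝ 1 u) :
    ∫ x, fderiv ℝ u x (field τ e φ x) = -∫ x, fieldDiv τ e φ x * u x := by
  have hdu : ∀ k, Continuous fun x => fderiv ℝ u x (e k).nor := fun k =>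
    (hu.continuous_fderiv one_ne_zero).clm_apply continuous_const
  have hfl : ∀ k, Continuous fun x => (e k).flux φ ((e k).s x) := fun k =>
    ((e k).continuous_flux hφ.continuous).comp (e k).continuous_s
  have h1 : ∀ x, fderiv ℝ u x (field τ e φ x) = ∑ k, ((e k).tri τ).indicator
      (fun x => (e k).hat τ x * ((e k).flux φ ((e k).s x) * fderiv ℝ u x (e k).nor)) x := by
    intro x
    rw [field, map_sum]
    refine Finset.sum_congr rfl fun k _ => ?_
    by_cases hx : x ∈ (e k).tri τ
    · simp only [indicator_of_mem hx, map_smul, smul_eq_mul, mul_assoc]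
    · simp only [indicator_of_notMem hx, map_zero]
  have h2 : ∀ x, fieldDiv τ e φ x * u x = -∑ k, ((e k).tri τ).indicator
      (fun x => (e k).weight τ x * ((e k).flux φ ((e k).s x) * u x)) x := by
    intro x
    rw [fieldDiv, neg_mul, Finset.sum_mul]
    congr 1
    refine Finset.sum_congr rfl fun k _ => ?_
    by_cases hx : x ∈ (e k).tri τ
    · simp only [indicator_of_mem hx, mul_assoc]
    · simp only [indicator_of_notMem hx, zero_mul]
  simp only [h1, h2]
  rw [integral_neg, neg_neg, integral_finsetSum, integral_finsetSum]
  · simp only [integral_indicator (Edge.measurableSet_tri _)]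
    have h3 := fun k => (e k).integral_tri_hat_mul hτ hu ((e k).continuous_flux hφ.continuous)
    simp only [h3]
    rw [Finset.sum_sub_distrib]
    have hΦ : ContDiff ℝ 1 fun x => u x • φ x := hu.smul hφ
    have hsupp : Function.support (fun x => u x • φ x) ⊆ Function.support φ :=
      fun x hx h0 => hx (by simp [h0])
    have h4 := h.sum_integral_flux hτ hΦ (hc.mono hsupp) ((closure_mono hsupp).trans hφΩ)
    have h5 : ∀ k a, (e k).flux (fun x => u x • φ x) a = (e k).flux φ a * u ((e k).pt a 0) := by
      intro k a
      rw [Edge.flux, inner_smul_left, Edge.flux, mul_comm]; rfl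
    simp only [h5] at h4
    rw [h4, sub_zero]
  · intro k _
    rw [integrable_indicator_iff (e k).measurableSet_tri]
    exact (e k).integrableOn_weight_mul hτ ((hfl k).mul hu.continuous)
  · intro k _
    rw [integrable_indicator_iff (e k).measurableSet_tri]
    exact (e k).integrableOn_hat_mul hτ ((hfl k).mul (hdu k))

lemma setIntegral_fieldDiv (h : EdgePartition τ Ω R e) (hτ : 0 < τ) {φ : Plane → Plane}
    (hφ : ContDiff ℝ 1 φ) (hc : HasCompactSupport φ) (i : I) :
    ∫ x in R i, fieldDiv τ e φ x = ∫ x in R i, divergence φ x := by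
  have hfl : ∀ k, Continuous fun x => (e k).flux φ ((e k).s x) := fun k =>
    ((e k).continuous_flux hφ.continuous).comp (e k).continuous_s
  rw [(h.edgeSystem i).integral_divergence hτ hφ hc]
  simp only [fieldDiv]
  rw [integral_neg, integral_finsetSum, Fintype.sum_sigma, Finset.sum_eq_single i]
  · congr 1
    refine Finset.sum_congr rfl fun k _ => ?_
    rw [setIntegral_indicator (e ⟨i, k⟩).measurableSet_tri,
      inter_eq_right.2 ((h.tri_subset ⟨i, k⟩).trans interior_subset),
      (e ⟨i, k⟩).integral_tri_weight_mul hτ ((e ⟨i, k⟩).continuous_flux hφ.continuous)]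
    rfl
  · intro j _ hj
    refine Finset.sum_eq_zero fun k _ => ?_
    rw [setIntegral_indicator (e ⟨j, k⟩).measurableSet_tri]
    refine setIntegral_measure_zero _ (measure_mono_null ?_ (h.aedisjoint hj.symm))
    exact inter_subset_inter_right _ ((h.tri_subset ⟨j, k⟩).trans interior_subset)
  · simp
  · intro k _
    refine Integrable.integrableOn ?_
    rw [integrable_indicator_iff (e k).measurableSet_tri]
    exact (e k).integrableOn_weight_mul hτ (hfl k)

/-- A piecewise constant function pairs in the same way with the divergence of a field and with
the weak divergence of the interpolated field. -/
lemma integral_sum_mul_fieldDiv (h : EdgePartition τ Ω R e) (hτ : 0 < τ) {φ : Plane → Plane}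
    (hφ : ContDiff ℝ 1 φ) (hc : HasCompactSupport φ) (c : I → ℝ) :
    ∫ x in Ω, (∑ i, (R i).indicator (fun _ => c i) x) * fieldDiv τ e φ x
      = ∫ x in Ω, (∑ i, (R i).indicator (fun _ => c i) x) * divergence φ x := by
  have key : ∀ F : Plane → ℝ, Integrable F →
      ∫ x in Ω, (∑ i, (R i).indicator (fun _ => c i) x) * F x
        = ∑ i, c i * ∫ x in R i, F x := by
    intro F hF
    have h1 : ∀ x, (∑ i, (R i).indicator (fun _ => c i) x) * F x
        = ∑ i, (R i).indicator (fun x => c i * F x) x := by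
      intro x
      rw [Finset.sum_mul]
      refine Finset.sum_congr rfl fun i _ => ?_
      by_cases hx : x ∈ R i
      · simp only [indicator_of_mem hx]
      · simp only [indicator_of_notMem hx, zero_mul]
    simp only [h1]
    rw [integral_finsetSum]
    · refine Finset.sum_congr rfl fun i _ => ?_
      rw [setIntegral_indicator (h.measurableSet i), inter_eq_right.2 (h.subset i),
        integral_const_mul]
    · exact fun i _ => ((hF.const_mul (c i)).indicator (h.measurableSet i)).integrableOn
  rw [key _ (integrable_fieldDiv hτ hφ.continuous),
    key _ ((continuous_divergence hφ).integrable_of_hasCompactSupport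
      (hasCompactSupport_divergence hc))]
  simp only [h.setIntegral_fieldDiv hτ hφ hc]

/-- The weak divergence of the interpolated field is controlled by the total variation. -/
lemma ofReal_integral_mul_fieldDiv_le (h : EdgePartition τ Ω R e) (hτ : 0 < τ)
    (hΩ : IsCompact Ω) {φ : Plane → Plane} (hφ : ContDiff ℝ 1 φ) (hc : HasCompactSupport φ)
    (hφΩ : tsupport φ ⊆ interior Ω) (hφ1 : ∀ x, ‖φ x‖ ≤ 1) {g : Plane → ℝ}
    (hg : Measurable g) {C : ℝ} (hgC : ∀ x, |g x| ≤ C) :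
    ENNReal.ofReal (∫ x in Ω, g x * fieldDiv τ e φ x) ≤ bvSeminorm Ω g := by
  obtain ⟨K, hK, hKΩ, hK0⟩ := h.exists_compact_field_eq_zero hΩ hφΩ
  exact ofReal_integral_mul_le_bvSeminorm hΩ hg hgC hK hKΩ (measurable_field hφ.continuous)
    (h.norm_field_le hτ hφ1) hK0 (integrable_fieldDiv hτ hφ.continuous)
    fun u hu _ => h.integral_fderiv_field hτ hφ hc hφΩ hu

end EdgePartition

namespace Edge

variable (e : Edge) {τ : ℝ}

/-- The singularity of the weight is integrable, uniformly with respect to the length of the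
edge. -/
lemma setLIntegral_weight_le (hτ : 0 < τ) {K : Set Plane} (hK : MeasurableSet K)
    (hKe : K ⊆ e.tri τ) :
    ∫⁻ x in K, ENNReal.ofReal (e.weight τ x)
      ≤ ENNReal.ofReal (1 + 2 / τ) * volume K ^ ((1 : ℝ) / 2) := by
  rcases eq_or_ne (volume K) 0 with h0 | h0
  · rw [setLIntegral_measure_zero _ _ h0]; exact zero_le
  have hfin : volume K ≠ ∞ := ((measure_mono hKe).trans_lt (e.measure_tri_lt_top hτ)).ne
  set v := (volume K).toReal with hv
  have hv0 : 0 < v := ENNReal.toReal_pos h0 hfin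
  have hKv : volume K = ENNReal.ofReal v := (ENNReal.ofReal_toReal hfin).symm
  set r := Real.sqrt v with hr
  have hr0 : 0 < r := Real.sqrt_pos.2 hv0
  have hrv : r * r = v := Real.mul_self_sqrt hv0.le
  set h : ℝ → ℝ≥0∞ := {a | e.gap a < r / τ}.indicator 1 with hh
  have hgap : Continuous e.gap := e.continuous_gap
  have hm : MeasurableSet {a | e.gap a < r / τ} := measurableSet_lt hgap.measurable measurable_const
  have hhm : Measurable h := measurable_one.indicator hm
  have h1 : ∀ x ∈ K, ENNReal.ofReal (e.weight τ x)
      ≤ ENNReal.ofReal r⁻¹ + h (e.s x) * ENNReal.ofReal (e.weight τ x) := by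
    intro x hx
    by_cases hg : e.gap (e.s x) < r / τ
    · have : h (e.s x) = 1 := by rw [hh, indicator_of_mem (by exact hg)]; rfl
      rw [this, one_mul]
      exact le_add_self
    · refine le_add_right (ENNReal.ofReal_le_ofReal ?_)
      rw [weight]
      refine inv_anti₀ hr0 ?_
      rw [not_lt, div_le_iff₀ hτ] at hg
      linarith
  have h2 : ∫⁻ a in Ioo 0 e.len, h a ≤ ENNReal.ofReal (2 * (r / τ)) := by
    rw [hh, lintegral_indicator_one hm, Measure.restrict_apply hm]
    have : {a | e.gap a < r / τ} ∩ Ioo 0 e.len ⊆ Ioo 0 (r / τ) ∪ Ioo (e.len - r / τ) e.len := by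
      rintro a ⟨ha, ha1, ha2⟩
      rcases min_lt_iff.1 (show min a (e.len - a) < r / τ from ha) with h | h
      · exact Or.inl ⟨ha1, h⟩
      · exact Or.inr ⟨by linarith, ha2⟩
    refine (measure_mono this).trans ((measure_union_le _ _).trans ?_)
    rw [Real.volume_Ioo, Real.volume_Ioo, sub_zero, _root_.sub_sub_cancel,
      ← ENNReal.ofReal_add (by positivity) (by positivity), two_mul]
  have hroot : volume K ^ ((1 : ℝ) / 2) = ENNReal.ofReal r := by
    rw [hKv, ENNReal.ofReal_rpow_of_pos hv0, hr, Real.sqrt_eq_rpow]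
  calc ∫⁻ x in K, ENNReal.ofReal (e.weight τ x)
      ≤ ∫⁻ x in K, (ENNReal.ofReal r⁻¹ + h (e.s x) * ENNReal.ofReal (e.weight τ x)) :=
        setLIntegral_mono' hK h1
    _ = ENNReal.ofReal r⁻¹ * volume K
        + ∫⁻ x in K, h (e.s x) * ENNReal.ofReal (e.weight τ x) := by
        rw [lintegral_add_left measurable_const, setLIntegral_const]
    _ ≤ ENNReal.ofReal r⁻¹ * volume K + ENNReal.ofReal (2 * (r / τ)) := by
        gcongr
        refine (lintegral_mono_set hKe).trans ?_
        rw [e.lintegral_weight hτ hhm]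
        exact h2
    _ = ENNReal.ofReal (1 + 2 / τ) * volume K ^ ((1 : ℝ) / 2) := by
        rw [hroot, hKv, ← ENNReal.ofReal_mul (by positivity), ← ENNReal.ofReal_mul (by positivity),
          ← ENNReal.ofReal_add (by positivity) (by positivity)]
        congr 1
        rw [← hrv]
        field_simp

/-- The closed triangle over an edge. -/
def closedTri (τ : ℝ) : Set Plane :=
  {x | 0 ≤ e.t x ∧ e.t x ≤ τ * e.s x ∧ e.t x ≤ τ * (e.len - e.s x)}

lemma tri_subset_closedTri : e.tri τ ⊆ e.closedTri τ := fun _ hx => ⟨hx.1.le, hx.2.1.le, hx.2.2.le⟩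

lemma seg_subset_closedTri (hτ : 0 < τ) : e.seg ⊆ e.closedTri τ := by
  rintro x ⟨h1, h2, h3⟩
  refine ⟨h1.ge, ?_, ?_⟩ <;> rw [h1]
  · exact mul_nonneg hτ.le h2
  · exact mul_nonneg hτ.le (by linarith)

lemma dist_le_of_mem_closedTri (hτ : 0 < τ) {x y : Plane} (hx : x ∈ e.closedTri τ)
    (hy : y ∈ e.closedTri τ) : dist x y ≤ (1 + τ) * e.len := by
  have key : ∀ z ∈ e.closedTri τ, 0 ≤ e.s z ∧ e.s z ≤ e.len ∧ e.t z ≤ τ * e.len := by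
    rintro z ⟨h1, h2, h3⟩
    have h4 : 0 ≤ e.s z := nonneg_of_mul_nonneg_right (h1.trans h2) hτ
    have h5 : 0 ≤ e.len - e.s z := nonneg_of_mul_nonneg_right (h1.trans h3) hτ
    exact ⟨h4, by linarith, h3.trans (by gcongr; linarith)⟩
  obtain ⟨a1, a2, a3⟩ := key x hx
  obtain ⟨b1, b2, b3⟩ := key y hy
  have h1 : |e.s x - e.s y| ≤ e.len := abs_le.2 ⟨by linarith, by linarith⟩
  have h2 : |e.t x - e.t y| ≤ τ * e.len := abs_le.2 ⟨by linarith [hx.1], by linarith [hy.1]⟩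
  linarith [e.dist_le x y]

/-- Near each of its points, the triangle contains a ball of comparable size. -/
lemma exists_ball_subset_tri (hτ : 0 < τ) {x : Plane} (hx : x ∈ e.closedTri τ) {r : ℝ}
    (hr : 0 < r) (hre : r ≤ e.len) :
    ∃ y, ball y (τ / (8 * (1 + τ)) * r) ⊆ e.tri τ ∩ closedBall x ((1 + τ) * r) := by
  set κ := τ / (8 * (1 + τ)) with hκ
  have hκτ : κ * (1 + τ) = τ / 8 := by rw [hκ]; field_simp
  have hκ0 : 0 < κ := by positivity
  have hl := e.len_pos
  set c := e.pt (e.len / 2) (τ * e.len / 4) with hc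
  have hball : ball c (κ * e.len) ⊆ e.tri τ := by
    intro z hz
    have h1 := (e.abs_s_sub_le z c).trans_lt hz
    have h2 := (e.abs_t_sub_le z c).trans_lt hz
    rw [hc, s_pt, abs_lt] at h1
    rw [hc, t_pt, abs_lt] at h2
    have h3 : κ * e.len + τ * (κ * e.len) = τ * e.len / 8 := by linear_combination e.len * hκτ
    have h4 : 0 < τ * e.len := by positivity
    have h5 : 0 < τ * (κ * e.len) := by positivity
    refine ⟨by linarith, ?_, ?_⟩
    · have := mul_lt_mul_of_pos_left (show e.len / 2 - κ * e.len < e.s z by linarith) hτ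
      linarith
    · have := mul_lt_mul_of_pos_left (show e.len / 2 - κ * e.len < e.len - e.s z by linarith) hτ
      linarith
  set η := r / e.len with hη
  have hη0 : 0 < η := by positivity
  have hη1 : η ≤ 1 := (div_le_one hl).2 hre
  have hηl : η * e.len = r := div_mul_cancel₀ r hl.ne'
  refine ⟨(1 - η) • x + η • c, fun z hz => ?_⟩
  obtain ⟨w, hw⟩ : ∃ w, z = (1 - η) • x + η • w := by
    refine ⟨η⁻¹ • (z - (1 - η) • x), ?_⟩
    rw [smul_inv_smul₀ hη0.ne']; abel
  have hwc : w ∈ ball c (κ * e.len) := by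
    rw [mem_ball, hw, dist_add_left, dist_smul₀, Real.norm_eq_abs, abs_of_pos hη0, ← hηl] at hz
    rw [mem_ball]
    refine lt_of_mul_lt_mul_left ?_ hη0.le
    linarith
  have hwt := hball hwc
  constructor
  · obtain ⟨h1, h2, h3⟩ := hx
    obtain ⟨g1, g2, g3⟩ := hwt
    have hη' : 0 ≤ 1 - η := by linarith
    rw [tri, mem_ofPred_eq, hw, e.t_combo _ _ (by ring), e.s_combo _ _ (by ring)]
    have a1 := mul_lt_mul_of_pos_left g1 hη0
    have a2 := mul_lt_mul_of_pos_left g2 hη0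
    have a3 := mul_lt_mul_of_pos_left g3 hη0
    have b1 := mul_le_mul_of_nonneg_left h1 hη'
    have b2 := mul_le_mul_of_nonneg_left h2 hη'
    have b3 := mul_le_mul_of_nonneg_left h3 hη'
    exact ⟨by linarith, by linarith, by linarith⟩
  · have hwx := e.dist_le_of_mem_closedTri hτ (e.tri_subset_closedTri hwt) hx
    have h1 : z - x = η • (w - x) := by rw [hw, smul_sub, sub_smul, one_smul]; abel
    rw [mem_closedBall, dist_eq_norm, h1, norm_smul, Real.norm_eq_abs, abs_of_pos hη0,
      ← dist_eq_norm, ← hηl]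
    calc η * dist w x ≤ η * ((1 + τ) * e.len) := by gcongr
      _ = _ := by ring

end Edge

/-- Disjoint balls of radius `a` inside a ball of radius `b`. -/
lemma card_mul_sq_le_of_pairwiseDisjoint_ball {α : Type*} {F : Finset α} {c : α → Plane}
    {x : Plane} {a b : ℝ} (ha : 0 ≤ a) (hb : 0 ≤ b)
    (hd : (F : Set α).PairwiseDisjoint fun i => ball (c i) a)
    (hs : ∀ i ∈ F, ball (c i) a ⊆ closedBall x b) : F.card * a ^ 2 ≤ b ^ 2 := by
  have h1 : ∑ i ∈ F, volume (ball (c i) a) ≤ volume (closedBall x b) := by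
    rw [← measure_biUnion_finset hd fun i _ => measurableSet_ball]
    exact measure_mono (iUnion₂_subset hs)
  have hv : volume (ball (0 : Plane) 1) ≠ ∞ := measure_ball_lt_top.ne
  have hv0 : volume (ball (0 : Plane) 1) ≠ 0 := (measure_ball_pos _ _ one_pos).ne'
  simp only [Measure.addHaar_ball _ _ ha, Measure.addHaar_closedBall _ _ hb, Finset.sum_const,
    nsmul_eq_mul, ← mul_assoc, finrank_euclideanSpace_fin] at h1
  rw [ENNReal.mul_le_mul_iff_left hv0 hv, ← ENNReal.ofReal_natCast,
    ← ENNReal.ofReal_mul (Nat.cast_nonneg _), ENNReal.ofReal_le_ofReal_iff (by positivity)] at h1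
  exact h1

/-- The maximal number of disjoint triangles of slope `τ` and length at least `r` which meet
a ball of radius `(1 + τ) * r`. -/
def packingBound (τ : ℝ) : ℝ := (16 * (1 + τ) ^ 2 / τ) ^ 2

lemma card_le_packingBound {τ : ℝ} (hτ : 0 < τ) {α : Type*} {e : α → Edge}
    (hd : Pairwise fun i j => Disjoint ((e i).tri τ) ((e j).tri τ)) {F : Finset α} {x : Plane}
    {r : ℝ} (hr : 0 < r) (hF : ∀ i ∈ F, r ≤ (e i).len ∧
      ∃ y ∈ (e i).closedTri τ, dist y x ≤ (1 + τ) * r) : (F.card : ℝ) ≤ packingBound τ := by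
  have hch : ∀ i, ∃ y, i ∈ F → ball y (τ / (8 * (1 + τ)) * r)
      ⊆ (e i).tri τ ∩ closedBall x (2 * (1 + τ) * r) := by
    intro i
    by_cases hi : i ∈ F
    · obtain ⟨h1, y, hy, hyx⟩ := hF i hi
      obtain ⟨z, hz⟩ := (e i).exists_ball_subset_tri hτ hy hr h1
      refine ⟨z, fun _ => hz.trans (inter_subset_inter_right _ ?_)⟩
      exact closedBall_subset_closedBall' (by linarith)
    · exact ⟨0, fun h => absurd h hi⟩
  choose c hc using hch
  have := card_mul_sq_le_of_pairwiseDisjoint_ball (F := F) (c := c) (x := x)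
    (a := τ / (8 * (1 + τ)) * r) (b := 2 * (1 + τ) * r) (by positivity) (by positivity)
    (fun i hi j hj hij => (hd hij).mono ((hc i hi).trans inter_subset_left)
      ((hc j hj).trans inter_subset_left))
    (fun i hi => (hc i hi).trans inter_subset_right)
  have h2 : (2 * (1 + τ) * r) ^ 2 = packingBound τ * (τ / (8 * (1 + τ)) * r) ^ 2 := by
    rw [packingBound, ← mul_pow]; congr 1; field_simp; ring
  rw [h2] at this
  exact le_of_mul_le_mul_right this (by positivity)

/-- Number of incidences between the triangles of one family and the edges of another one. -/
lemma card_tri_inter_seg_le {τ : ℝ} (hτ : 0 < τ) {K M : Type*} [Fintype K] [Fintype M]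
    {e : K → Edge} {e' : M → Edge}
    (hd : Pairwise fun i j => Disjoint ((e i).tri τ) ((e j).tri τ))
    (hd' : Pairwise fun i j => Disjoint ((e' i).tri τ) ((e' j).tri τ)) :
    ((Finset.univ.filter fun p : K × M => ((e p.1).tri τ ∩ (e' p.2).seg).Nonempty).card : ℝ)
      ≤ packingBound τ * (Fintype.card K + Fintype.card M) := by
  set A := Finset.univ.filter fun p : K × M =>
    ((e p.1).tri τ ∩ (e' p.2).seg).Nonempty ∧ (e' p.2).len ≤ (e p.1).len with hA
  set B := Finset.univ.filter fun p : K × M =>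
    ((e p.1).tri τ ∩ (e' p.2).seg).Nonempty ∧ (e p.1).len ≤ (e' p.2).len with hB
  have hcover : (Finset.univ.filter fun p : K × M =>
      ((e p.1).tri τ ∩ (e' p.2).seg).Nonempty) ⊆ A ∪ B := by
    intro p hp
    rw [Finset.mem_filter] at hp
    rw [Finset.mem_union, hA, hB, Finset.mem_filter, Finset.mem_filter]
    rcases le_total (e' p.2).len (e p.1).len with h | h
    · exact Or.inl ⟨hp.1, hp.2, h⟩
    · exact Or.inr ⟨hp.1, hp.2, h⟩
  have hAc : (A.card : ℝ) ≤ packingBound τ * Fintype.card M := by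
    rw [hA, Finset.card_filter, Fintype.sum_prod_type_right, Nat.cast_sum, mul_comm]
    simp only [← Finset.card_filter]
    rw [← nsmul_eq_mul, ← Finset.card_univ]
    refine Finset.sum_le_card_nsmul _ _ _ fun m _ => ?_
    refine card_le_packingBound hτ hd (x := (e' m).base) (e' m).len_pos fun k hk => ?_
    obtain ⟨-, ⟨y, hy, hym⟩, hl⟩ := Finset.mem_filter.1 hk
    refine ⟨hl, y, (e k).tri_subset_closedTri hy, ?_⟩
    refine (e' m).dist_le_of_mem_closedTri hτ ((e' m).seg_subset_closedTri hτ hym)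
      ((e' m).seg_subset_closedTri hτ ?_)
    exact ⟨by simp [Edge.t], by simp [Edge.s], by simpa [Edge.s] using (e' m).len_pos.le⟩
  have hBc : (B.card : ℝ) ≤ packingBound τ * Fintype.card K := by
    rw [hB, Finset.card_filter, Fintype.sum_prod_type, Nat.cast_sum, mul_comm]
    simp only [← Finset.card_filter]
    rw [← nsmul_eq_mul, ← Finset.card_univ]
    refine Finset.sum_le_card_nsmul _ _ _ fun k _ => ?_
    refine card_le_packingBound hτ hd' (x := (e k).base) (e k).len_pos fun m hm => ?_
    obtain ⟨-, ⟨y, hy, hym⟩, hl⟩ := Finset.mem_filter.1 hm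
    refine ⟨hl, y, (e' m).seg_subset_closedTri hτ hym, ?_⟩
    exact (e k).tri_subset_closedBall hτ hy
  have h1 := (Finset.card_le_card hcover).trans (Finset.card_union_le A B)
  have h2 : ((Finset.univ.filter fun p : K × M =>
      ((e p.1).tri τ ∩ (e' p.2).seg).Nonempty).card : ℝ) ≤ A.card + B.card := by exact_mod_cast h1
  linarith

namespace EdgePartition

variable {τ : ℝ} {Ω : Set Plane} {I J : Type*} {R : I → Set Plane} {ι : I → Type*}
  {e : (Σ i, ι i) → Edge} {R' : J → Set Plane} {κ : J → Type*} {e' : (Σ j, κ j) → Edge}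
  [Fintype I] [∀ i, Fintype (ι i)] [Fintype J] [∀ j, Fintype (κ j)]

/-- Number of incidences between the triangles of one partition and the sets of another one. -/
lemma card_tri_inter_le (hτ : 0 < τ) (h : EdgePartition τ Ω R e) (h' : EdgePartition τ Ω R' e') :
    ((Finset.univ.filter fun p : (Σ i, ι i) × J =>
        volume ((e p.1).tri τ ∩ R' p.2) ≠ 0).card : ℝ)
      ≤ (1 + packingBound τ) * (Fintype.card (Σ i, ι i) + Fintype.card (Σ j, κ j)) := by
  set Q := Finset.univ.filter fun p : (Σ i, ι i) × (Σ j, κ j) =>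
    ((e p.1).tri τ ∩ (e' p.2).seg).Nonempty with hQ
  set A := Finset.univ.filter fun p : (Σ i, ι i) × J =>
    volume ((e p.1).tri τ ∩ R' p.2) ≠ 0 ∧ (e p.1).tri τ ⊆ interior (R' p.2) with hA
  have hcover : (Finset.univ.filter fun p : (Σ i, ι i) × J =>
      volume ((e p.1).tri τ ∩ R' p.2) ≠ 0) ⊆ A ∪ Q.image fun p => (p.1, p.2.1) := by
    rintro ⟨k, j⟩ hp
    have hp' := (Finset.mem_filter.1 hp).2
    rw [Finset.mem_union]
    by_cases hin : (e k).tri τ ⊆ interior (R' j)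
    · exact Or.inl (Finset.mem_filter.2 ⟨Finset.mem_univ _, hp', hin⟩)
    · right
      have hne : ((e k).tri τ ∩ interior (R' j)).Nonempty := by
        by_contra hemp
        rw [not_nonempty_iff_eq_empty] at hemp
        refine hp' (measure_mono_null (fun x hx => ?_) (h'.edgeSystem j).volume_frontier)
        refine ⟨subset_closure hx.2, fun hxi => ?_⟩
        exact (hemp ▸ mem_inter hx.1 hxi : x ∈ (∅ : Set Plane))
      have hfr : ((e k).tri τ ∩ frontier (R' j)).Nonempty := by
        by_contra hemp
        rw [not_nonempty_iff_eq_empty] at hemp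
        refine hin (((e k).convex_tri τ).isPreconnected.subset_left_of_subset_union isOpen_interior
          (isClosed_closure.isOpen_compl (s := closure (R' j)))
          (disjoint_compl_right.mono_left (interior_subset.trans subset_closure)) ?_ hne)
        intro x hx
        by_cases hxi : x ∈ interior (R' j)
        · exact Or.inl hxi
        · exact Or.inr fun hxc => (hemp ▸ mem_inter hx ⟨hxc, hxi⟩ : x ∈ (∅ : Set Plane))
      rw [(h'.edgeSystem j).frontier_eq] at hfr
      obtain ⟨x, hx, hx'⟩ := hfr
      obtain ⟨l, hl⟩ := mem_iUnion.1 hx'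
      exact Finset.mem_image.2 ⟨(k, ⟨j, l⟩),
        Finset.mem_filter.2 ⟨Finset.mem_univ _, x, hx, hl⟩, rfl⟩
  have hAc : A.card ≤ Fintype.card (Σ i, ι i) := by
    refine Finset.card_le_card_of_injOn Prod.fst (fun _ _ => Finset.mem_univ _) ?_
    rintro ⟨k, j⟩ hj ⟨k', j'⟩ hj' hkk
    obtain rfl : k = k' := hkk
    obtain ⟨-, h1, h2⟩ := Finset.mem_filter.1 hj
    obtain ⟨-, -, h3⟩ := Finset.mem_filter.1 hj'
    obtain ⟨x, hx, -⟩ := nonempty_of_measure_ne_zero h1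
    by_contra hne
    have := h'.disjoint_interior j j' fun hh => hne (by rw [hh])
    exact (this ▸ mem_inter (h2 hx) (h3 hx) : x ∈ (∅ : Set Plane))
  have hQc := card_tri_inter_seg_le hτ h.disjoint_tri h'.disjoint_tri
  have h1 := (Finset.card_le_card hcover).trans (Finset.card_union_le _ _)
  have h2 := h1.trans (Nat.add_le_add hAc Finset.card_image_le)
  have h3 : ((Finset.univ.filter fun p : (Σ i, ι i) × J =>
      volume ((e p.1).tri τ ∩ R' p.2) ≠ 0).card : ℝ) ≤ Fintype.card (Σ i, ι i) + Q.card := by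
    exact_mod_cast h2
  have h4 : (0 : ℝ) ≤ Fintype.card (Σ j, κ j) := Nat.cast_nonneg _
  linarith

lemma ae_sum_indicator_eq (h : EdgePartition τ Ω R e) (c : I → ℝ) :
    ∀ᵐ x, ∀ i, x ∈ R i → ∑ i', (R i').indicator (fun _ => c i') x = c i := by
  have h0 : ∀ᵐ x : Plane, ∀ i j, i ≠ j → x ∉ R i ∩ R j := by
    rw [ae_all_iff]; intro i
    rw [ae_all_iff]; intro j
    by_cases hij : i = j
    · exact Filter.Eventually.of_forall fun x hne => absurd hij hne
    · filter_upwards [measure_eq_zero_iff_ae_notMem.1 (h.aedisjoint hij)] with x hx _ using hx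
  filter_upwards [h0] with x hx i hi
  rw [Finset.sum_eq_single i, indicator_of_mem hi]
  · exact fun j _ hj => indicator_of_notMem (fun hxj => hx i j hj.symm ⟨hi, hxj⟩) _
  · simp

/-- The integral of the difference of two piecewise constants against the weights of a
partition. -/
lemma lintegral_sub_mul_weight_le (hτ : 0 < τ) (h : EdgePartition τ Ω R e)
    (h' : EdgePartition τ Ω R' e') (c : I → ℝ) (c' : J → ℝ) {f : Plane → ℝ}
    (hf : ∀ x, f x = ∑ i, (R i).indicator (fun _ => c i) x -
      ∑ j, (R' j).indicator (fun _ => c' j) x) :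
    ∑ k, ∫⁻ x in (e k).tri τ, ‖f x‖ₑ * ENNReal.ofReal ((e k).weight τ x)
      ≤ ENNReal.ofReal (1 + 2 / τ) *
        (ENNReal.ofReal ((1 + packingBound τ) *
            (Fintype.card (Σ i, ι i) + Fintype.card (Σ j, κ j)))) ^ ((1 : ℝ) / 2)
        * eLpNorm f 2 (volume.restrict Ω) := by
  set P := Finset.univ.filter fun p : (Σ i, ι i) × J =>
    volume ((e p.1).tri τ ∩ R' p.2) ≠ 0 with hP
  set T : (Σ i, ι i) × J → Set Plane := fun p => (e p.1).tri τ ∩ R' p.2 with hT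
  have hTm : ∀ p, MeasurableSet (T p) := fun p =>
    (e p.1).measurableSet_tri.inter (h'.measurableSet _)
  have hTΩ : ∀ p, T p ⊆ Ω := fun p => inter_subset_right.trans (h'.subset _)
  set a : (Σ i, ι i) × J → ℝ≥0∞ := fun p => ‖c p.1.1 - c' p.2‖ₑ with ha
  have hfa : ∀ p, ∀ᵐ x, x ∈ T p → ‖f x‖ₑ = a p := by
    rintro ⟨k, j⟩
    filter_upwards [h.ae_sum_indicator_eq c, h'.ae_sum_indicator_eq c'] with x hx hx' hxT
    rw [hf, hx k.1 (interior_subset (h.tri_subset k hxT.1)), hx' j hxT.2]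
  have h1 : ∀ p, ∫⁻ x in T p, ‖f x‖ₑ * ENNReal.ofReal ((e p.1).weight τ x)
      ≤ ENNReal.ofReal (1 + 2 / τ) * (1 * (a p * volume (T p) ^ ((1 : ℝ) / 2))) := by
    intro p
    calc ∫⁻ x in T p, ‖f x‖ₑ * ENNReal.ofReal ((e p.1).weight τ x)
        = ∫⁻ x in T p, a p * ENNReal.ofReal ((e p.1).weight τ x) := by
          refine setLIntegral_congr_fun_ae (hTm p) ?_
          filter_upwards [hfa p] with x hx hxT
          rw [hx hxT]
      _ = a p * ∫⁻ x in T p, ENNReal.ofReal ((e p.1).weight τ x) :=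
          lintegral_const_mul _ ((e p.1).measurable_weight τ).ennreal_ofReal
      _ ≤ a p * (ENNReal.ofReal (1 + 2 / τ) * volume (T p) ^ ((1 : ℝ) / 2)) := by
          gcongr
          exact (e p.1).setLIntegral_weight_le hτ (hTm p) inter_subset_left
      _ = _ := by rw [one_mul]; ring
  have hdisj : Pairwise (Function.onFun (AEDisjoint volume) T) := by
    rintro ⟨k, j⟩ ⟨k', j'⟩ hne
    by_cases hk : k = k'
    · have hj : j ≠ j' := fun hj => hne (by rw [hk, hj])
      exact (h'.aedisjoint hj).mono inter_subset_right inter_subset_right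
    · exact ((h.disjoint_tri hk).mono inter_subset_left inter_subset_left).aedisjoint
  have h2 : ∑ p ∈ P, (a p * volume (T p) ^ ((1 : ℝ) / 2)) ^ (2 : ℝ)
      ≤ ∫⁻ x in Ω, ‖f x‖ₑ ^ (2 : ℝ) := by
    have h3 : ∀ p, (a p * volume (T p) ^ ((1 : ℝ) / 2)) ^ (2 : ℝ)
        = ∫⁻ x in T p, ‖f x‖ₑ ^ (2 : ℝ) := by
      intro p
      rw [ENNReal.mul_rpow_of_nonneg _ _ zero_le_two, ← ENNReal.rpow_mul,
        one_div_mul_cancel two_ne_zero, ENNReal.rpow_one, ← setLIntegral_const]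
      refine setLIntegral_congr_fun_ae (hTm p) ?_
      filter_upwards [hfa p] with x hx hxT
      rw [hx hxT]
    simp only [h3]
    rw [← lintegral_biUnion_finset₀ (fun p _ q _ hpq => hdisj hpq)
      fun p _ => (hTm p).nullMeasurableSet]
    exact lintegral_mono_set (iUnion₂_subset fun p _ => hTΩ p)
  have h4 : ∑ p ∈ P, 1 * (a p * volume (T p) ^ ((1 : ℝ) / 2))
      ≤ (ENNReal.ofReal ((1 + packingBound τ) *
            (Fintype.card (Σ i, ι i) + Fintype.card (Σ j, κ j)))) ^ ((1 : ℝ) / 2)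
        * eLpNorm f 2 (volume.restrict Ω) := by
    refine (ENNReal.inner_le_Lp_mul_Lq P (fun _ => 1) _ Real.HolderConjugate.two_two).trans ?_
    rw [eLpNorm_eq_lintegral_rpow_enorm_toReal two_ne_zero ENNReal.ofNat_ne_top]
    refine mul_le_mul' (ENNReal.rpow_le_rpow ?_ (by norm_num))
      (ENNReal.rpow_le_rpow ?_ (by norm_num))
    · rw [Finset.sum_const, ENNReal.one_rpow, nsmul_eq_mul, mul_one, ← ENNReal.ofReal_natCast]
      exact ENNReal.ofReal_le_ofReal (card_tri_inter_le hτ h h')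
    · simpa using h2
  calc ∑ k, ∫⁻ x in (e k).tri τ, ‖f x‖ₑ * ENNReal.ofReal ((e k).weight τ x)
      ≤ ∑ k, ∑ j, ∫⁻ x in T (k, j), ‖f x‖ₑ * ENNReal.ofReal ((e k).weight τ x) := by
        refine Finset.sum_le_sum fun k _ => ?_
        have : (e k).tri τ = ⋃ j, T (k, j) := by
          simp only [hT]
          rw [← inter_iUnion, h'.iUnion_eq, eq_comm, inter_eq_left]
          exact (h.tri_subset k).trans (interior_subset.trans (h.subset _))
        conv_lhs => rw [this]
        refine (lintegral_iUnion_le _ _).trans ?_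
        rw [tsum_fintype]
    _ = ∑ p, ∫⁻ x in T p, ‖f x‖ₑ * ENNReal.ofReal ((e p.1).weight τ x) := by
        rw [Fintype.sum_prod_type]
    _ = ∑ p ∈ P, ∫⁻ x in T p, ‖f x‖ₑ * ENNReal.ofReal ((e p.1).weight τ x) := by
        refine (Finset.sum_filter_of_ne fun p _ hne => ?_).symm
        refine fun h0 => hne ?_
        exact setLIntegral_measure_zero _ _ h0
    _ ≤ ∑ p ∈ P, ENNReal.ofReal (1 + 2 / τ) * (1 * (a p * volume (T p) ^ ((1 : ℝ) / 2))) :=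
        Finset.sum_le_sum fun p _ => h1 p
    _ ≤ _ := by
        rw [← Finset.mul_sum, mul_assoc]
        gcongr

/-- The Bernstein type estimate for piecewise constants over two partitions of the same set. -/
theorem bvSeminorm_le (hτ : 0 < τ) (hΩ : IsCompact Ω) (h : EdgePartition τ Ω R e)
    (h' : EdgePartition τ Ω R' e') (c : I → ℝ) (c' : J → ℝ) :
    bvSeminorm Ω (fun x => ∑ i, (R i).indicator (fun _ => c i) x)
      ≤ bvSeminorm Ω (fun x => ∑ j, (R' j).indicator (fun _ => c' j) x)
        + ENNReal.ofReal (1 + 2 / τ) *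
          (ENNReal.ofReal ((1 + packingBound τ) *
            (Fintype.card (Σ i, ι i) + Fintype.card (Σ j, κ j)))) ^ ((1 : ℝ) / 2)
          * eLpNorm (fun x => ∑ i, (R i).indicator (fun _ => c i) x
              - ∑ j, (R' j).indicator (fun _ => c' j) x) 2 (volume.restrict Ω) := by
  set S := fun x => ∑ i, (R i).indicator (fun _ => c i) x with hS
  set S' := fun x => ∑ j, (R' j).indicator (fun _ => c' j) x with hS'
  have hSm : Measurable S := h.measurable_sum_indicator c
  have hSm' : Measurable S' := h'.measurable_sum_indicator c'
  rw [bvSeminorm]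
  refine iSup₂_le fun φ hφ => ?_
  obtain ⟨hφ, hc, hφΩ, hφ1⟩ := hφ
  have hD := integrable_fieldDiv (e := e) hτ hφ.continuous
  have hint : ∀ {g : Plane → ℝ} {C : ℝ}, Measurable g → (∀ x, |g x| ≤ C) →
      IntegrableOn (fun x => g x * fieldDiv τ e φ x) Ω := fun hg hC =>
    (hD.bdd_mul hg.aestronglyMeasurable (Filter.Eventually.of_forall hC)).integrableOn
  have hi := hint hSm (abs_sum_indicator_le c)
  have hi' := hint hSm' (abs_sum_indicator_le c')
  have h1 : ∫ x in Ω, S x * divergence φ x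
      = (∫ x in Ω, S' x * fieldDiv τ e φ x) + ∫ x in Ω, (S x - S' x) * fieldDiv τ e φ x := by
    rw [← h.integral_sum_mul_fieldDiv hτ hφ hc c]
    simp only [sub_mul]
    rw [integral_sub hi hi']
    ring
  change ENNReal.ofReal (∫ x in Ω, S x * divergence φ x) ≤ _
  rw [h1]
  refine ENNReal.ofReal_add_le.trans (add_le_add ?_ ?_)
  · exact h.ofReal_integral_mul_fieldDiv_le hτ hΩ hφ hc hφΩ hφ1 hSm' (abs_sum_indicator_le c')
  · refine le_trans ?_ (lintegral_sub_mul_weight_le hτ h h' c c' fun x => rfl)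
    calc ENNReal.ofReal (∫ x in Ω, (S x - S' x) * fieldDiv τ e φ x)
        ≤ ‖∫ x in Ω, (S x - S' x) * fieldDiv τ e φ x‖ₑ := by
          rw [← ofReal_norm]
          exact ENNReal.ofReal_le_ofReal (le_abs_self _)
      _ ≤ ∫⁻ x in Ω, ‖(S x - S' x) * fieldDiv τ e φ x‖ₑ := enorm_integral_le_lintegral_enorm _
      _ ≤ ∫⁻ x, ‖(S x - S' x) * fieldDiv τ e φ x‖ₑ := setLIntegral_le_lintegral _ _
      _ ≤ ∫⁻ x, ∑ k, ((e k).tri τ).indicator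
            (fun x => ‖S x - S' x‖ₑ * ENNReal.ofReal ((e k).weight τ x)) x := by
          refine lintegral_mono fun x => ?_
          rw [enorm_mul]
          have h2 : ‖fieldDiv τ e φ x‖ₑ
              ≤ ∑ k, ((e k).tri τ).indicator (fun x => ENNReal.ofReal ((e k).weight τ x)) x := by
            rw [← ofReal_norm]
            refine (ENNReal.ofReal_le_ofReal (abs_fieldDiv_le hτ hφ1 x)).trans ?_
            rw [ENNReal.ofReal_sum_of_nonneg]
            · refine Finset.sum_le_sum fun k _ => ?_
              by_cases hx : x ∈ (e k).tri τ
              · rw [indicator_of_mem hx, indicator_of_mem hx]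
              · rw [indicator_of_notMem hx, indicator_of_notMem hx, ENNReal.ofReal_zero]
            · exact fun k _ => indicator_nonneg (fun y hy => ((e k).weight_pos hτ hy).le) x
          refine (mul_le_mul_right h2 _).trans ?_
          rw [Finset.mul_sum]
          refine Finset.sum_le_sum fun k _ => ?_
          by_cases hx : x ∈ (e k).tri τ
          · rw [indicator_of_mem hx, indicator_of_mem hx]
          · rw [indicator_of_notMem hx, indicator_of_notMem hx, mul_zero]
      _ = ∑ k, ∫⁻ x in (e k).tri τ, ‖S x - S' x‖ₑ * ENNReal.ofReal ((e k).weight τ x) := by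
          rw [lintegral_finsetSum]
          · exact Finset.sum_congr rfl fun k _ => lintegral_indicator (e k).measurableSet_tri _
          · exact fun k _ => ((hSm.sub hSm').enorm.mul
              ((e k).measurable_weight τ).ennreal_ofReal).indicator (e k).measurableSet_tri

end EdgePartition

namespace Edge

lemma seg_eq_segment (e : Edge) : e.seg = segment ℝ e.base (e.pt e.len 0) := by
  have hl := e.len_pos
  have hb : e.s e.base = 0 ∧ e.t e.base = 0 := by simp [s, t]
  ext x
  constructor
  · rintro ⟨h1, h2, h3⟩
    refine ⟨1 - e.s x / e.len, e.s x / e.len, ?_, by positivity, by ring, ?_⟩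
    · rw [sub_nonneg]; exact (div_le_one hl).2 h3
    · have hx := e.pt_s_t x
      rw [h1] at hx
      simp only [pt, zero_smul, add_zero] at hx ⊢
      rw [smul_add, ← add_assoc, ← add_smul, sub_add_cancel, one_smul, smul_smul,
        div_mul_cancel₀ _ hl.ne', hx]
  · rintro ⟨a, b, ha, hb', hab, rfl⟩
    rw [seg, mem_ofPred_eq, e.t_combo _ _ hab, e.s_combo _ _ hab, hb.1, hb.2]
    simp only [s_pt, t_pt, mul_zero, add_zero, zero_add, true_and]
    exact ⟨by positivity, mul_le_of_le_one_left hl.le (by linarith)⟩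

/-- An edge with given endpoints whose normal points to the side of a given point. -/
lemma exists_base_pt_eq {a b : Plane} (hab : a ≠ b) (c : Plane) :
    ∃ e : Edge, e.base = a ∧ e.pt e.len 0 = b ∧ 0 ≤ e.t c := by
  have hl : 0 < ‖b - a‖ := norm_pos_iff.2 (sub_ne_zero.2 hab.symm)
  set u : Plane := ‖b - a‖⁻¹ • (b - a) with hu
  have hu1 : ‖u‖ = 1 := by
    rw [hu, norm_smul, norm_inv, norm_norm, inv_mul_cancel₀ hl.ne']
  have hlu : ‖b - a‖ • u = b - a := by rw [hu, smul_inv_smul₀ hl.ne']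
  have hfr : ∃ f : OrthonormalBasis (Fin 2) ℝ Plane, f 0 = u := by
    obtain ⟨f, hf⟩ := Orthonormal.exists_orthonormalBasis_extension_of_card_eq
      (𝕜 := ℝ) (E := Plane) (ι := Fin 2) (by simp) (v := fun _ => u) (s := {0})
      (by
        rw [orthonormal_iff_ite]
        rintro ⟨i, rfl⟩ ⟨j, rfl⟩
        simp [domRestrict, hu1])
    exact ⟨f, hf 0 rfl⟩
  obtain ⟨f, hf⟩ := hfr
  have hpt : ∀ g : OrthonormalBasis (Fin 2) ℝ Plane, g 0 = u →
      (Edge.mk a g ‖b - a‖ hl).pt ‖b - a‖ 0 = b := by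
    intro g hg
    simp [pt, hg, hlu]
  rcases le_total 0 (inner ℝ (f 1) (c - a)) with h | h
  · exact ⟨⟨a, f, ‖b - a‖, hl⟩, rfl, hpt f hf, h⟩
  · obtain ⟨g, hg⟩ := Orthonormal.exists_orthonormalBasis_extension_of_card_eq
      (𝕜 := ℝ) (E := Plane) (ι := Fin 2) (by simp) (v := ![f 0, -f 1]) (s := univ)
      (by
        have h01 : inner ℝ (f 0) (f 1) = (0 : ℝ) := f.orthonormal.2 (by decide)
        have h10 : inner ℝ (f 1) (f 0) = (0 : ℝ) := f.orthonormal.2 (by decide)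
        rw [orthonormal_iff_ite]
        rintro ⟨i, -⟩ ⟨j, -⟩
        fin_cases i <;> fin_cases j <;> simp [domRestrict, h01, h10])
    refine ⟨⟨a, g, ‖b - a‖, hl⟩, rfl, hpt g ((hg 0 trivial).trans hf), ?_⟩
    have : g 1 = -f 1 := hg 1 trivial
    simp only [t, nor, this, inner_neg_left]
    linarith

lemma t_eq_of_eqOn (e e' : Edge) {O : Set Plane} (hO : IsOpen O) (hne : O.Nonempty)
    (h : EqOn e.t e'.t O) : e.t = e'.t := by
  obtain ⟨x, hx⟩ := hne
  obtain ⟨r, hr, hrO⟩ := Metric.isOpen_iff.1 hO x hx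
  funext y
  set δ := r / (2 * (dist y x + 1)) with hδ
  have hd : 0 ≤ dist y x := dist_nonneg
  have hδ0 : 0 < δ := by positivity
  have hz : (1 - δ) • x + δ • y ∈ O := by
    apply hrO
    have : (1 - δ) • x + δ • y - x = δ • (y - x) := by rw [sub_smul, smul_sub, one_smul]; abel
    rw [mem_ball, dist_eq_norm, this, norm_smul, ← dist_eq_norm, Real.norm_eq_abs, abs_of_pos hδ0,
      hδ, div_mul_eq_mul_div, div_lt_iff₀ (by positivity)]
    nlinarith
  have h1 := h hx
  have h2 := h hz
  rw [e.t_combo _ _ (by ring), e'.t_combo _ _ (by ring), h1] at h2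
  exact mul_left_cancel₀ hδ0.ne' (by linarith)

/-- Edges with overlapping triangles and the same normal coordinate have two common points. -/
lemma exists_ne_mem_seg_of_t_eq (e e' : Edge) {τ : ℝ} (hτ : 0 < τ) (h : e.t = e'.t)
    (hne : (e.tri τ ∩ e'.tri τ).Nonempty) :
    ∃ x y, x ≠ y ∧ x ∈ e.seg ∧ y ∈ e.seg ∧ x ∈ e'.seg ∧ y ∈ e'.seg := by
  have hnor : e.nor = e'.nor := by
    refine ext_inner_right ℝ fun v => ?_
    have h1 := e.t_sub v 0
    have h2 := e'.t_sub v 0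
    rw [sub_zero] at h1 h2
    rw [← h1, ← h2, h]
  have key : ∀ x ∈ e.tri τ ∩ e'.tri τ, x - e.t x • e.nor ∈ e.seg ∩ e'.seg := by
    have aux : ∀ (d : Edge) (x : Plane), x ∈ d.tri τ → x - d.t x • d.nor ∈ d.seg := by
      intro d x hx
      have h1 := d.pt_s_t x
      have h2 : x - d.t x • d.nor = d.pt (d.s x) 0 := by
        rw [pt] at h1
        rw [sub_eq_iff_eq_add, pt, zero_smul, add_zero, h1]
      have h3 := d.s_mem_of_mem_tri hτ hx
      rw [h2]
      exact ⟨by simp, by simpa using h3.1.le, by simpa using h3.2.le⟩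
    intro x hx
    refine ⟨aux e x hx.1, ?_⟩
    rw [h, hnor]
    exact aux e' x hx.2
  obtain ⟨x, hx⟩ := hne
  obtain ⟨r, hr, hrO⟩ := Metric.isOpen_iff.1 ((e.isOpen_tri τ).inter (e'.isOpen_tri τ)) x hx
  set y := e.pt (e.s x + r / 2) (e.t x) with hy
  have hyO : y ∈ e.tri τ ∩ e'.tri τ := by
    apply hrO
    refine (e.dist_le y x).trans_lt ?_
    simp only [hy, s_pt, t_pt, add_sub_cancel_left, sub_self, abs_zero, add_zero]
    rw [abs_of_pos (by positivity)]
    linarith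
  refine ⟨_, _, fun hxy => ?_, (key x hx).1, (key y hyO).1, (key x hx).2, (key y hyO).2⟩
  rw [hy, t_pt, sub_left_inj, ← hy] at hxy
  have := congrArg e.s hxy
  rw [hy, s_pt] at this
  linarith

/-- A triangle with base angles `β` contains a disc around each point of the triangle with base
angles `β / 2` which touches the base line. -/
lemma ball_subset_closedTri (e : Edge) {β : ℝ} (hβ : 0 < β) (hβ' : β < Real.pi / 2) {x : Plane}
    (h1 : e.t x ≤ Real.sin β / (1 + Real.cos β) * e.s x)
    (h2 : e.t x ≤ Real.sin β / (1 + Real.cos β) * (e.len - e.s x)) :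
    ball x (e.t x) ⊆ e.closedTri (Real.tan β) := by
  have hc : 0 < Real.cos β := Real.cos_pos_of_mem_Ioo ⟨by linarith, hβ'⟩
  have hs : 0 < Real.sin β := Real.sin_pos_of_pos_of_lt_pi hβ (by linarith [Real.pi_pos])
  have hsc := Real.sin_sq_add_cos_sq β
  intro y hy
  rw [mem_ball] at hy
  have ht0 : 0 < e.t x := dist_nonneg.trans_lt hy
  have htt := (e.abs_t_sub_le y x).trans_lt hy
  have hd := e.dist_sq y x
  have hd' : dist y x ^ 2 < e.t x ^ 2 := by gcongr
  rw [div_mul_eq_mul_div, le_div_iff₀ (by positivity)] at h1 h2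
  have cs : ∀ p q : ℝ, p ^ 2 + q ^ 2 = 1 →
      p * (e.s y - e.s x) + q * (e.t y - e.t x) < e.t x := by
    intro p q hpq
    refine lt_of_pow_lt_pow_left₀ 2 ht0.le ?_
    nlinarith [sq_nonneg (p * (e.t y - e.t x) - q * (e.s y - e.s x))]
  have a1 := cs (-Real.sin β) (Real.cos β) (by linarith [neg_sq (Real.sin β)])
  have a2 := cs (Real.sin β) (Real.cos β) hsc
  rw [Real.tan_eq_sin_div_cos]
  refine ⟨by linarith [(abs_lt.1 htt).1], ?_, ?_⟩
  · rw [div_mul_eq_mul_div, le_div_iff₀ hc]; nlinarith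
  · rw [div_mul_eq_mul_div, le_div_iff₀ hc]; nlinarith

end Edge

/-- A good triangle in terms of edges. -/
lemma HasGoodTriangle.exists_edge {β : ℝ} (hβ : 0 < β) (hβ' : β < Real.pi / 2) {R : Set Plane}
    {a b : Plane} (h : HasGoodTriangle β R a b) :
    ∃ e : Edge, e.base = a ∧ e.pt e.len 0 = b ∧ e.closedTri (Real.tan β) ⊆ R := by
  obtain ⟨c, hR, ha, hb⟩ := h
  have hab : a ≠ b := by
    rintro rfl
    rw [EuclideanGeometry.angle, vsub_self, InnerProductGeometry.angle_zero_left] at ha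
    linarith
  obtain ⟨e, hea, heb, hec⟩ := Edge.exists_base_pt_eq hab c
  have hcos : 0 < Real.cos β := Real.cos_pos_of_mem_Ioo ⟨by linarith, hβ'⟩
  have hsin : 0 < Real.sin β := Real.sin_pos_of_pos_of_lt_pi hβ (by linarith [Real.pi_pos])
  have hsc := Real.sin_sq_add_cos_sq β
  have hl := e.len_pos
  have hsa : e.s a = 0 := by rw [← hea]; simp [Edge.s]
  have hta : e.t a = 0 := by rw [← hea]; simp [Edge.t]
  have hsb : e.s b = e.len := by rw [← heb]; simp
  have htb : e.t b = 0 := by rw [← heb]; simp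
  have hba : b - a = e.len • e.frame 0 := by rw [← heb, ← hea]; simp [Edge.pt]
  have hu : ‖e.frame 0‖ = 1 := e.frame.orthonormal.1 0
  have hnab : ‖b - a‖ = e.len := by rw [hba, norm_smul, hu, mul_one, Real.norm_of_nonneg hl.le]
  have e1 : Real.cos β * dist c a = e.s c := by
    have := InnerProductGeometry.cos_angle_mul_norm_mul_norm (b - a) (c - a)
    rw [show InnerProductGeometry.angle (b - a) (c - a) = β from ha, hnab, hba, inner_smul_left,
      ← e.s_sub, hsa, ← dist_eq_norm] at this
    simp only [conj_trivial, sub_zero] at this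
    exact mul_left_cancel₀ hl.ne' (by linarith)
  have e2 : Real.cos β * dist c b = e.len - e.s c := by
    have := InnerProductGeometry.cos_angle_mul_norm_mul_norm (a - b) (c - b)
    rw [show InnerProductGeometry.angle (a - b) (c - b) = β from hb, norm_sub_rev, hnab,
      ← neg_sub b a, hba, inner_neg_left, inner_smul_left, ← e.s_sub, hsb, ← dist_eq_norm] at this
    simp only [conj_trivial] at this
    exact mul_left_cancel₀ hl.ne' (by linarith)
  have d1 := e.dist_sq c a
  have d2 := e.dist_sq c b
  rw [hsa, hta, sub_zero, sub_zero] at d1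
  rw [hsb, htb, sub_zero] at d2
  have n1 : 0 ≤ e.s c := by rw [← e1]; positivity
  have n2 : 0 ≤ e.len - e.s c := by rw [← e2]; positivity
  have q1 : (Real.cos β * e.t c) ^ 2 = (Real.sin β * e.s c) ^ 2 := by
    have : e.s c ^ 2 = Real.cos β ^ 2 * dist c a ^ 2 := by rw [← e1]; ring
    nlinarith
  have q2 : (Real.cos β * e.t c) ^ 2 = (Real.sin β * (e.len - e.s c)) ^ 2 := by
    have : (e.len - e.s c) ^ 2 = Real.cos β ^ 2 * dist c b ^ 2 := by rw [← e2]; ring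
    nlinarith
  have r1 := (pow_left_inj₀ (by positivity) (by positivity) two_ne_zero).1 q1
  have r2 := (pow_left_inj₀ (by positivity) (by positivity) two_ne_zero).1 q2
  have hsc2 : e.s c = e.len / 2 := by
    have := mul_left_cancel₀ hsin.ne' (r1.symm.trans r2)
    linarith
  set T := Real.tan β with hT
  have hT0 : 0 < T := by rw [hT, Real.tan_eq_sin_div_cos]; positivity
  have htc : e.t c = T * (e.len / 2) := by
    rw [hT, Real.tan_eq_sin_div_cos, ← hsc2, div_mul_eq_mul_div, eq_div_iff hcos.ne', ← r1]
    ring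
  refine ⟨e, hea, heb, fun x hx => hR ?_⟩
  obtain ⟨h1, h2, h3⟩ := hx
  set wc := e.t x / (T * (e.len / 2)) with hwc
  have hwc' : wc * (T * (e.len / 2)) = e.t x := div_mul_cancel₀ _ (by positivity)
  set wb := e.s x / e.len - wc / 2 with hwb
  have hwb' : wb * e.len = e.s x - wc / 2 * e.len := by
    rw [hwb, sub_mul, div_mul_cancel₀ _ hl.ne']
  have p1 : 0 ≤ wc := by positivity
  have p2 : 0 ≤ wb := by
    refine nonneg_of_mul_nonneg_left ?_ hl
    rw [hwb']
    refine nonneg_of_mul_nonneg_right ?_ hT0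
    linarith
  have p3 : 0 ≤ 1 - wb - wc := by
    refine nonneg_of_mul_nonneg_left ?_ hl
    have : (1 - wb - wc) * e.len = e.len - e.s x - wc / 2 * e.len := by
      rw [sub_mul, sub_mul, hwb']; ring
    rw [this]
    refine nonneg_of_mul_nonneg_right ?_ hT0
    linarith
  have hx : x = (1 - wb - wc) • a + wb • b + wc • c := by
    have hs : x - a = wb • (b - a) + wc • (c - a) := by
      rw [← e.pt_s_t x, ← e.pt_s_t c, hba, hsc2, htc, Edge.pt, Edge.pt, hea]
      have g1 : e.s x = wb * e.len + wc * (e.len / 2) := by rw [hwb']; ring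
      conv_lhs => rw [g1, ← hwc']
      module
    rw [← sub_eq_zero] at hs ⊢
    rw [← hs]
    module
  have hmem : ∀ z ∈ ({a, b, c} : Set Plane), z ∈ convexHull ℝ {a, b, c} :=
    fun z hz => subset_convexHull ℝ _ hz
  rw [hx]
  refine (convex_convexHull ℝ {a, b, c}).sum_mem (t := Finset.univ)
    (w := ![1 - wb - wc, wb, wc]) (z := ![a, b, c]) ?_ ?_ ?_ |> fun h => by
      simpa [Fin.sum_univ_three] using h
  · intro i _
    fin_cases i
    exacts [p3, p2, p1]
  · rw [Fin.sum_univ_three]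
    change 1 - wb - wc + wb + wc = 1
    ring
  · intro i _; fin_cases i <;> exact hmem _ (by simp)

lemma exists_lineMap_eq {x y a b : Plane} (hxy : x ≠ y) (hx : x ∈ segment ℝ a b)
    (hy : y ∈ segment ℝ a b) :
    ∃ p q : ℝ, segment ℝ a b = AffineMap.lineMap x y '' uIcc p q ∧ 0 ∈ uIcc p q := by
  have hinj := AffineMap.lineMap_injective ℝ hxy
  have hx' := hx
  rw [segment_eq_image_lineMap] at hx hy
  obtain ⟨s, -, rfl⟩ := hx
  obtain ⟨t, -, rfl⟩ := hy
  have hst : t - s ≠ 0 := fun h => hxy (by rw [sub_eq_zero.1 h])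
  set x := AffineMap.lineMap a b s with hxd
  set y := AffineMap.lineMap a b t with hyd
  have key : ∀ r : ℝ, AffineMap.lineMap x y ((r - s) / (t - s)) = AffineMap.lineMap a b r := by
    intro r
    have h1 : y - x = (t - s) • (b - a) := by
      simp only [hxd, hyd, AffineMap.lineMap_apply_module]
      module
    rw [AffineMap.lineMap_apply, vsub_eq_sub, h1, smul_smul, div_mul_cancel₀ _ hst, hxd,
      AffineMap.lineMap_apply_module, AffineMap.lineMap_apply_module, vadd_eq_add]
    module
  have hseg : segment ℝ a b
      = AffineMap.lineMap x y '' uIcc ((0 - s) / (t - s)) ((1 - s) / (t - s)) := by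
    rw [← segment_eq_uIcc, image_segment, key, key]
    simp
  refine ⟨_, _, hseg, ?_⟩
  rw [hseg] at hx'
  obtain ⟨z, hz, hzx⟩ := hx'
  have : z = 0 := hinj (by rw [hzx]; simp)
  rwa [this] at hz

lemma exists_segment_eq_union {x y a b c d : Plane} (hxy : x ≠ y) (hx : x ∈ segment ℝ a b)
    (hy : y ∈ segment ℝ a b) (hx' : x ∈ segment ℝ c d) (hy' : y ∈ segment ℝ c d) :
    ∃ p q, segment ℝ a b ∪ segment ℝ c d = segment ℝ p q := by
  obtain ⟨p, q, h1, h2⟩ := exists_lineMap_eq hxy hx hy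
  obtain ⟨p', q', h1', h2'⟩ := exists_lineMap_eq hxy hx' hy'
  refine ⟨AffineMap.lineMap x y (min (p ⊓ q) (p' ⊓ q')),
    AffineMap.lineMap x y (max (p ⊔ q) (p' ⊔ q')), ?_⟩
  rw [h1, h1', ← image_union, ← image_segment, uIcc, uIcc,
    Icc_union_Icc' (h2'.1.trans h2.2) (h2.1.trans h2'.2), segment_eq_uIcc, uIcc_of_le]
  exact (min_le_left _ _).trans (inf_le_sup.trans (le_max_left _ _))

lemma segment_union_segment {v w p : Plane} (hp : p ∈ segment ℝ v w) :
    segment ℝ v p ∪ segment ℝ p w = segment ℝ v w := by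
  refine subset_antisymm (union_subset ?_ ?_) ?_
  · exact (convex_segment v w).segment_subset (left_mem_segment ℝ v w) hp
  · exact (convex_segment v w).segment_subset hp (right_mem_segment ℝ v w)
  · rw [segment_eq_image_lineMap ℝ v w] at hp ⊢
    obtain ⟨r, hr, rfl⟩ := hp
    have h1 := image_segment ℝ (AffineMap.lineMap v w) (0 : ℝ) r
    have h2 := image_segment ℝ (AffineMap.lineMap v w) r (1 : ℝ)
    rw [AffineMap.lineMap_apply_zero, segment_eq_Icc hr.1] at h1
    rw [AffineMap.lineMap_apply_one, segment_eq_Icc hr.2] at h2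
    rw [← h1, ← h2, ← image_union, Icc_union_Icc_eq_Icc hr.1 hr.2]

lemma eq_of_mem_segment_of_mem_segment {v w p x : Plane} (hp : p ∈ segment ℝ v w)
    (h1 : x ∈ segment ℝ v p) (h2 : x ∈ segment ℝ p w) : x = p := by
  rw [mem_segment_iff_wbtw] at *
  have := hp.trans_left_right h1
  exact (wbtw_swap_left_iff ℝ w).1 ⟨this, h2⟩

/-- A segment contained in `F` which is not contained in a longer one. -/
def IsMaximalSegment (F M : Set Plane) : Prop :=
  (∃ v w, M = segment ℝ v w) ∧ M ⊆ F ∧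
    ∀ a b, M ⊆ segment ℝ a b → segment ℝ a b ⊆ F → segment ℝ a b = M

namespace IsMaximalSegment

variable {F M N : Set Plane}

lemma segment_subset (h : IsMaximalSegment F M) {x y a b : Plane} (hxy : x ≠ y) (hx : x ∈ M)
    (hy : y ∈ M) (hab : segment ℝ a b ⊆ F) (hx' : x ∈ segment ℝ a b) (hy' : y ∈ segment ℝ a b) :
    segment ℝ a b ⊆ M := by
  obtain ⟨⟨v, w, rfl⟩, hF, hmax⟩ := h
  obtain ⟨p, q, hpq⟩ := exists_segment_eq_union hxy hx hy hx' hy'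
  have := hmax p q (hpq ▸ subset_union_left) (hpq ▸ union_subset hF hab)
  rw [← this, ← hpq]
  exact subset_union_right

lemma eq_of_mem (h : IsMaximalSegment F M) (h' : IsMaximalSegment F N) {x y : Plane}
    (hxy : x ≠ y) (hx : x ∈ M) (hy : y ∈ M) (hx' : x ∈ N) (hy' : y ∈ N) : M = N := by
  obtain ⟨a, b, rfl⟩ := h.1
  obtain ⟨c, d, rfl⟩ := h'.1
  exact (h'.segment_subset hxy hx' hy' h.2.1 hx hy).antisymm
    (h.segment_subset hxy hx hy h'.2.1 hx' hy')

end IsMaximalSegment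

/-- The number of nondegenerate maximal segments in a union of `n` segments is at most `n`. -/
lemma card_le_of_isMaximalSegment {F : Set Plane} {ρ α : Type*} [Fintype ρ] [Fintype α]
    {M : ρ → Set Plane} (hM : ∀ r, IsMaximalSegment F (M r)) (hinj : Function.Injective M)
    (hnt : ∀ r, (M r).Nontrivial) {v w : α → Plane} (hF : F = ⋃ a, segment ℝ (v a) (w a)) :
    Fintype.card ρ ≤ Fintype.card α := by
  have key : ∀ r, ∃ a, (M r ∩ segment ℝ (v a) (w a)).Nontrivial := by
    intro r
    have hinf : (M r).Infinite := by
      obtain ⟨a, b, hab⟩ := (hM r).1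
      have : IsPreconnected (M r) := hab ▸ (convex_segment a b).isPreconnected
      exact this.infinite_of_nontrivial (hnt r)
    by_contra! hcon
    refine hinf (Set.Finite.subset (finite_iUnion fun a => (hcon a).finite) ?_)
    rw [← inter_iUnion, ← hF]
    exact subset_inter subset_rfl (hM r).2.1
  choose f hf using key
  refine Fintype.card_le_of_injective f fun r r' hrr => hinj ?_
  have hsub : ∀ r, segment ℝ (v (f r)) (w (f r)) ⊆ M r := by
    intro r
    obtain ⟨x, hx, y, hy, hxy⟩ := hf r
    refine (hM r).segment_subset hxy hx.1 hy.1 ?_ hx.2 hy.2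
    rw [hF]
    exact subset_iUnion (fun a => segment ℝ (v a) (w a)) (f r)
  obtain ⟨x, hx, y, hy, hxy⟩ := hf r
  refine (hM r).eq_of_mem (hM r') hxy hx.1 hy.1 ?_ ?_
  · exact hsub r' (hrr ▸ hx.2)
  · exact hsub r' (hrr ▸ hy.2)

namespace Edge

lemma ext_coord (e : Edge) {x y : Plane} (hs : e.s x = e.s y) (ht : e.t x = e.t y) : x = y := by
  rw [← e.pt_s_t x, ← e.pt_s_t y, hs, ht]

lemma exists_combo_mem_tri (e : Edge) {T : ℝ} (hT : 0 < T) {p z : Plane} (hp : e.t p = 0)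
    (hps : e.s p ∈ Ioo 0 e.len) (hz : 0 < e.t z) :
    ∃ ε ∈ Ioo (0 : ℝ) 1, (1 - ε) • p + ε • z ∈ e.tri T := by
  have h1 : ∀ᶠ ε in nhds (0 : ℝ), ε * e.t z < T * ((1 - ε) * e.s p + ε * e.s z) :=
    ContinuousAt.eventually_lt (by fun_prop) (by fun_prop) (by simpa using mul_pos hT hps.1)
  have h2 : ∀ᶠ ε in nhds (0 : ℝ), ε * e.t z < T * (e.len - ((1 - ε) * e.s p + ε * e.s z)) :=
    ContinuousAt.eventually_lt (by fun_prop) (by fun_prop)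
      (by simpa using mul_pos hT (sub_pos.2 hps.2))
  have h3 : ∀ᶠ ε in nhdsWithin (0 : ℝ) (Ioi 0), ε ∈ Ioo (0 : ℝ) 1 := Ioo_mem_nhdsGT one_pos
  obtain ⟨ε, ⟨h1, h2⟩, h3⟩ :=
    (((h1.and h2).filter_mono nhdsWithin_le_nhds).and h3).exists
  have hs := e.s_combo (1 - ε) ε (by ring) p z
  have ht := e.t_combo (1 - ε) ε (by ring) p z
  rw [hp, mul_zero, zero_add] at ht
  exact ⟨ε, h3, by rw [ht]; exact mul_pos h3.1 hz, by rw [ht, hs]; exact h1,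
    by rw [ht, hs]; exact h2⟩

/-- Near the relative interior of an edge, the difference of two convex sets lies on one side. -/
lemma exists_gap_le (e : Edge) {T : ℝ} (hT : 0 < T) {Q₁ Q₂ : Set Plane} (hc₁ : Convex ℝ Q₁)
    (hc₂ : Convex ℝ Q₂) (hQ₂ : IsClosed Q₂) (hi : Q₂ ⊆ closure (interior Q₂))
    (htri : e.closedTri T ⊆ Q₁ \ interior Q₂) (hseg : e.seg ⊆ frontier Q₁ ∪ frontier Q₂) :
    ∃ A, ∀ x ∈ Q₁ \ interior Q₂, e.t x < 0 → 0 < e.s x → e.s x < e.len →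
      e.gap (e.s x) ≤ A * |e.t x| := by
  by_cases hcase : ∃ p ∈ frontier Q₁, e.t p = 0 ∧ e.s p ∈ Ioo 0 e.len
  · obtain ⟨p, hp, htp, hsp⟩ := hcase
    refine ⟨0, fun x hx htx _ _ => ?_⟩
    have hz : e.t ((2 : ℝ) • p + (-1 : ℝ) • x) = - e.t x := by
      rw [e.t_combo _ _ (by norm_num), htp]; ring
    obtain ⟨ε, hε, hy⟩ := e.exists_combo_mem_tri hT htp hsp (hz ▸ neg_pos.2 htx)
    have hyi := interior_maximal (fun y hy => (htri (e.tri_subset_closedTri hy)).1)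
      (e.isOpen_tri T) hy
    have hε1 : 0 < 1 + ε := by linarith [hε.1]
    have := hc₁.combo_interior_self_mem_interior hyi hx.1 (a := 1 / (1 + ε)) (b := ε / (1 + ε))
      (by positivity) (div_nonneg hε.1.le hε1.le) (by field_simp)
    refine absurd ?_ hp.2
    convert this using 1
    match_scalars <;> field_simp <;> ring
  · push Not at hcase
    have hrel : ∀ p, e.t p = 0 → e.s p ∈ Ioo 0 e.len → p ∈ Q₂ := by
      intro p h1 h2
      rcases hseg ⟨h1, h2.1.le, h2.2.le⟩ with h | h
      · exact absurd h2 (hcase p h h1)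
      · exact hQ₂.frontier_subset h
    set p := e.pt (e.len / 2) 0 with hp
    have hl := e.len_pos
    have hp1 : e.t p = 0 := by simp [hp]
    have hp2 : e.s p ∈ Ioo 0 e.len := by
      rw [hp, s_pt]; constructor <;> linarith
    have hpQ := hrel p hp1 hp2
    have hle : ∀ z ∈ interior Q₂, e.t z ≤ 0 := by
      intro z hz
      by_contra! htz
      obtain ⟨ε, hε, hy⟩ := e.exists_combo_mem_tri hT hp1 hp2 htz
      refine (htri (e.tri_subset_closedTri hy)).2 ?_
      exact hc₂.combo_self_interior_mem_interior hpQ hz (by linarith [hε.2]) hε.1 (by ring)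
    obtain ⟨z, hz⟩ := closure_nonempty_iff.1 ⟨p, hi hpQ⟩
    have htz : e.t z < 0 := by
      refine lt_of_le_of_ne (hle z hz) fun h0 => ?_
      obtain ⟨r, hr, hrQ⟩ := Metric.isOpen_iff.1 isOpen_interior z hz
      have hmem : e.pt (e.s z) (r / 2) ∈ interior Q₂ := by
        apply hrQ
        refine (e.dist_le _ _).trans_lt ?_
        rw [s_pt, t_pt, h0, sub_self, abs_zero, zero_add, sub_zero, abs_of_pos (by positivity)]
        linarith
      have := hle _ hmem
      rw [t_pt] at this
      linarith
    have hq : 0 < -e.t z := neg_pos.2 htz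
    refine ⟨(|e.s z| + |e.len - e.s z| + e.len) / -e.t z, fun x hx htx h0 h1 => ?_⟩
    by_contra! hlt
    set θ := |e.t x| / -e.t z with hθ
    have hθ0 : 0 < θ := div_pos (abs_pos.2 htx.ne) hq
    rw [div_mul_eq_mul_div, mul_div_assoc, ← hθ] at hlt
    have hg := e.gap_le (e.s x)
    have g1 : e.gap (e.s x) ≤ e.s x := min_le_left _ _
    have g2 : e.gap (e.s x) ≤ e.len - e.s x := min_le_right _ _
    have a1 : 0 ≤ |e.s z| * θ := by positivity
    have a2 : 0 ≤ |e.len - e.s z| * θ := by positivity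
    have a3 : 0 < e.len * θ := by positivity
    have a4 : e.s z * θ ≤ |e.s z| * θ := by gcongr; exact le_abs_self _
    have a5 : (e.len - e.s z) * θ ≤ |e.len - e.s z| * θ := by gcongr; exact le_abs_self _
    have hθ1 : θ < 1 := by
      by_contra! h
      nlinarith
    have hθ2 : 0 < 1 - θ := by linarith
    refine hx.2 ?_
    have hy : e.pt ((e.s x - θ * e.s z) / (1 - θ)) 0 ∈ Q₂ := by
      refine hrel _ (by simp) ?_
      rw [s_pt]
      refine ⟨div_pos (by linarith) hθ2, ?_⟩
      rw [div_lt_iff₀ hθ2]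
      linarith
    have := hc₂.combo_self_interior_mem_interior hy hz hθ2.le hθ0 (by ring)
    convert this using 1
    refine e.ext_coord ?_ ?_
    · rw [e.s_combo _ _ (by ring), s_pt]
      field_simp
      ring
    · rw [e.t_combo _ _ (by ring), t_pt, hθ, abs_of_neg htx]
      have := htz.ne
      field_simp
      ring

end Edge

/-- The boundary of a ring is the union of the boundaries of its two convex sets. -/
lemma frontier_diff_interior {Q₁ Q₂ : Set Plane} (h₁ : IsClosed Q₁) (h₂ : IsClosed Q₂)
    (hsub : Q₂ ⊆ Q₁) (hi : Q₂ ⊆ closure (interior Q₂)) :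
    frontier (Q₁ \ interior Q₂) = frontier Q₁ ∪ frontier Q₂ := by
  have hcl : IsClosed (Q₁ \ interior Q₂) := h₁.sdiff isOpen_interior
  refine subset_antisymm ?_ (union_subset ?_ ?_)
  · rw [sdiff_eq]
    refine (frontier_inter_subset _ _).trans (union_subset_union inter_subset_left ?_)
    rw [frontier_compl]
    exact inter_subset_right.trans frontier_interior_subset
  · intro x hx
    rw [hcl.frontier_eq]
    exact ⟨⟨h₁.frontier_subset hx, fun h => hx.2 (interior_mono hsub h)⟩,
      fun h => hx.2 (interior_mono sdiff_subset h)⟩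
  · intro x hx
    rw [hcl.frontier_eq]
    refine ⟨⟨hsub (h₂.frontier_subset hx), hx.2⟩, fun h => ?_⟩
    obtain ⟨y, hy, hy'⟩ := mem_closure_iff.1 (hi (h₂.frontier_subset hx)) _ isOpen_interior h
    exact (interior_subset hy).2 hy'

lemma IsRegularConvexPolygon.subset_closure_interior {N₀ : ℕ} {c₀ : ℝ} {Q : Set Plane}
    (h : IsRegularConvexPolygon N₀ c₀ Q) : Q ⊆ closure (interior Q) := by
  obtain ⟨-, hconv, -, -, x₁, x, r₁, r, hr, hball, -⟩ := h
  rw [hconv.closure_interior_eq_closure_of_nonempty_interior]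
  · exact subset_closure
  · exact ⟨x, interior_maximal (ball_subset_closedBall.trans hball) isOpen_ball (mem_ball_self hr)⟩

lemma exists_eq_diff_of_isRing {N₀ : ℕ} {c₀ β : ℝ} {R : Set Plane} (h : IsRing N₀ c₀ β R) :
    ∃ Q₁ Q₂ : Set Plane, R = Q₁ \ interior Q₂ ∧ IsCompact Q₁ ∧ IsClosed Q₂ ∧ Convex ℝ Q₁ ∧
      Convex ℝ Q₂ ∧ Q₂ ⊆ Q₁ ∧ Q₂ ⊆ closure (interior Q₂) ∧
      ∃ (α : Type) (_ : Fintype α) (v w : α → Plane), Fintype.card α ≤ 2 * N₀ ∧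
        frontier Q₁ ∪ frontier Q₂ = ⋃ a, segment ℝ (v a) (w a) := by
  obtain ⟨⟨Q₁, Q₂, h₁, h₂, rfl⟩, -⟩ := h
  obtain ⟨m, v, w, hm, hF⟩ := h₁.2.2.2.1
  refine ⟨Q₁, Q₂, rfl, h₁.1, ?_⟩
  rcases h₂ with rfl | ⟨hsub, h₂⟩
  · refine ⟨isClosed_empty, h₁.2.1, convex_empty, empty_subset _, empty_subset _,
      Fin m, inferInstance, v, w, ?_, ?_⟩
    · rw [Fintype.card_fin]; omega
    · rw [hF, frontier_empty, union_empty]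
  · obtain ⟨m', v', w', hm', hF'⟩ := h₂.2.2.2.1
    refine ⟨h₂.1.isClosed, h₁.2.1, h₂.2.1, hsub, h₂.subset_closure_interior,
      Fin m ⊕ Fin m', inferInstance, Sum.elim v v', Sum.elim w w', ?_, ?_⟩
    · rw [Fintype.card_sum, Fintype.card_fin, Fintype.card_fin]; omega
    · rw [hF, hF', iUnion_sum]; rfl

/-- The boundary of a ring decomposes into a bounded number of edges. -/
lemma IsRing.exists_edgeSystem {N₀ : ℕ} {c₀ β : ℝ} (hβ : 0 < β) (hβ' : β < Real.pi / 2)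
    {R : Set Plane} (h : IsRing N₀ c₀ β R) :
    ∃ (ι : Type) (_ : Fintype ι) (e : ι → Edge),
      EdgeSystem (Real.sin β / (1 + Real.cos β)) R e ∧ Fintype.card ι ≤ 4 * N₀ := by
  obtain ⟨Q₁, Q₂, hR, hQ₁, hQ₂, hc₁, hc₂, hsub, hi, α, _, a, b, hα, hF⟩ :=
    exists_eq_diff_of_isRing h
  obtain ⟨-, m, v, w, hfr, hmax, hgood⟩ := h
  choose p hp hgl hgr using hgood
  have hfr' : frontier R = frontier Q₁ ∪ frontier Q₂ :=
    hR ▸ frontier_diff_interior hQ₁.isClosed hQ₂ hsub hi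
  have hcos : 0 < Real.cos β := Real.cos_pos_of_mem_Ioo ⟨by linarith, hβ'⟩
  have hsin : 0 < Real.sin β := Real.sin_pos_of_pos_of_lt_pi hβ (by linarith [Real.pi_pos])
  have hτ : 0 < Real.sin β / (1 + Real.cos β) := by positivity
  have hT : 0 < Real.tan β := Real.tan_pos_of_pos_of_lt_pi_div_two hβ hβ'
  choose l hl₁ hl₂ hl₃ using fun i => (hgl i).exists_edge hβ hβ'
  choose r hr₁ hr₂ hr₃ using fun i => (hgr i).exists_edge hβ hβ'
  have hlseg : ∀ i, (l i).seg = segment ℝ (v i) (p i) := fun i => by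
    rw [Edge.seg_eq_segment, hl₁, hl₂]
  have hrseg : ∀ i, (r i).seg = segment ℝ (p i) (w i) := fun i => by
    rw [Edge.seg_eq_segment, hr₁, hr₂]
  have hunion : ∀ i, (l i).seg ∪ (r i).seg = segment ℝ (v i) (w i) := fun i => by
    rw [hlseg, hrseg, segment_union_segment (hp i)]
  have hM : ∀ i, IsMaximalSegment (frontier R) (segment ℝ (v i) (w i)) := fun i =>
    ⟨⟨_, _, rfl⟩, hfr ▸ subset_iUnion (fun i => segment ℝ (v i) (w i)) i, hmax i⟩
  set ρ := range fun i => segment ℝ (v i) (w i) with hρ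
  have : Fintype ρ := Fintype.ofFinite ρ
  choose f hf using fun x : ρ => x.2
  have hf' : ∀ x : ρ, segment ℝ (v (f x)) (w (f x)) = x := hf
  set e : ρ × Bool → Edge := fun k => bif k.2 then l (f k.1) else r (f k.1) with he
  have heseg : ∀ k, (e k).seg ⊆ k.1 := by
    rintro ⟨x, _ | _⟩
    · exact hf' x ▸ hunion (f x) ▸ subset_union_right
    · exact hf' x ▸ hunion (f x) ▸ subset_union_left
  have hρM : ∀ x : ρ, IsMaximalSegment (frontier R) x := fun x => hf' x ▸ hM (f x)
  have hefr : ∀ k, (e k).seg ⊆ frontier R := fun k => (heseg k).trans (hρM k.1).2.1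
  have hetri : ∀ k, (e k).closedTri (Real.tan β) ⊆ R := by
    rintro ⟨x, _ | _⟩
    exacts [hr₃ _, hl₃ _]
  have hball : ∀ k x, 0 ≤ (e k).t x → (e k).t x ≤ Real.sin β / (1 + Real.cos β) * (e k).s x →
      (e k).t x ≤ Real.sin β / (1 + Real.cos β) * ((e k).len - (e k).s x) →
      ball x ((e k).t x) ⊆ R := fun k x _ h1 h2 =>
    ((e k).ball_subset_closedTri hβ hβ' h1 h2).trans (hetri k)
  refine ⟨ρ × Bool, inferInstance, e, ⟨?_, hball, ?_, ?_, ?_⟩, ?_⟩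
  · exact hR ▸ hQ₁.diff isOpen_interior
  · refine subset_antisymm ?_ (iUnion_subset hefr)
    rw [hfr]
    refine iUnion_subset fun i => ?_
    have h1 := hf' ⟨_, mem_range_self i⟩
    refine (show segment ℝ (v i) (w i) = _ from h1.symm).trans_subset ?_
    rw [← hunion]
    exact union_subset (subset_iUnion (fun k => (e k).seg) (_, true))
      (subset_iUnion (fun k => (e k).seg) (_, false))
  · intro k
    have h1 := hetri k
    rw [hR] at h1 ⊢
    exact (e k).exists_gap_le hT hc₁ hc₂ hQ₂ hi h1 (hfr' ▸ hefr k)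
  · intro j k hjk
    rw [Set.disjoint_iff_inter_eq_empty, ← Set.not_nonempty_iff_eq_empty]
    intro hne
    have ht : (e j).t = (e k).t :=
      (e j).t_eq_of_eqOn (e k) (((e j).isOpen_tri _).inter ((e k).isOpen_tri _)) hne fun x hx => by
        rw [← (e j).infDist_compl_eq hτ (hball j) (hefr j) hx.1,
          (e k).infDist_compl_eq hτ (hball k) (hefr k) hx.2]
    obtain ⟨x, y, hxy, hx, hy, hx', hy'⟩ := (e j).exists_ne_mem_seg_of_t_eq (e k) hτ ht hne
    have h1 : j.1 = k.1 := Subtype.ext ((hρM j.1).eq_of_mem (hρM k.1) hxy (heseg j hx) (heseg j hy)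
      (heseg k hx') (heseg k hy'))
    have key : ∀ i, ∀ z ∈ (l i).seg, z ∈ (r i).seg → z = p i := fun i z h2 h3 =>
      eq_of_mem_segment_of_mem_segment (hp i) (hlseg i ▸ h2) (hrseg i ▸ h3)
    obtain ⟨z, bj⟩ := j
    obtain ⟨z', bk⟩ := k
    obtain rfl : z = z' := h1
    rcases bj <;> rcases bk
    · exact hjk rfl
    · exact hxy ((key _ x hx' hx).trans (key _ y hy' hy).symm)
    · exact hxy ((key _ x hx hx').trans (key _ y hy hy').symm)
    · exact hjk rfl
  · have : Fintype.card ρ ≤ Fintype.card α := by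
      refine card_le_of_isMaximalSegment (M := fun x : ρ => (x : Set Plane)) hρM
        Subtype.val_injective (fun x => ?_) (hfr'.trans hF)
      refine ⟨v (f x), hf' x ▸ left_mem_segment ℝ _ _, p (f x), hf' x ▸ hp _, fun h0 => ?_⟩
      have := congrArg (l (f x)).s ((hl₁ _).trans (h0.trans (hl₂ _).symm))
      rw [Edge.s_pt] at this
      simp only [Edge.s, sub_self, inner_zero_right] at this
      exact (l (f x)).len_pos.ne this
    rw [Fintype.card_prod, Fintype.card_bool]
    omega

/-- A piecewise constant spline over a bounded domain, with the edges of its rings. -/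
lemma IsSpline.exists_edgePartition {N₀ : ℕ} {c₀ β : ℝ} (hβ : 0 < β) (hβ' : β < Real.pi / 2)
    {n : ℕ} {Ω : Set Plane} (hΩ : IsCompact Ω) {S : Plane → ℝ}
    (h : IsSpline N₀ c₀ β n 1 Ω S) :
    ∃ (R : Fin n → Set Plane) (ι : Fin n → Type) (_ : ∀ i, Fintype (ι i))
      (e : (Σ i, ι i) → Edge) (c : Fin n → ℝ),
      EdgePartition (Real.sin β / (1 + Real.cos β)) Ω R e ∧
      Fintype.card (Σ i, ι i) ≤ n * (4 * N₀) ∧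
      S = fun x => ∑ i, (R i).indicator (fun _ => c i) x := by
  obtain ⟨R, P, hR, hdisj, hU, hdeg, rfl, -⟩ := h
  have hU : ⋃ j, R j = Ω := by
    rcases hU with hU | ⟨rfl, -⟩
    · exact hU
    · exact absurd hΩ (noncompact_univ Plane)
  choose ι hι e he hcard using fun j => (hR j).exists_edgeSystem hβ hβ'
  refine ⟨R, ι, hι, fun k => e k.1 k.2, fun j => (P j).coeff 0, ⟨he, hdisj, hU⟩, ?_, ?_⟩
  · rw [Fintype.card_sigma]
    simpa using Finset.sum_le_card_nsmul Finset.univ _ _ fun i _ => hcard i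
  · have hP : ∀ j, P j = MvPolynomial.C ((P j).coeff 0) := fun j =>
      MvPolynomial.totalDegree_eq_zero_iff_eq_C.1 (Nat.lt_one_iff.1 (hdeg j))
    funext x
    refine Finset.sum_congr rfl fun j _ => ?_
    congr 1
    funext y
    conv_lhs => rw [hP j]
    rw [MvPolynomial.eval_C]

/-- **Bernstein-type estimate for piecewise constants, limiting BV case.** -/
theorem bv_bernstein_piecewise_constants (N₀ : ℕ) (c₀ β : ℝ) (hc₀ : 1 ≤ c₀) (hβ : 0 < β) (hβ' : β ≤ Real.pi / 3) :
    ∃ c : ℝ, 0 < c ∧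
      ∀ (Ω : Set Plane) (n₀ : ℕ), IsCompact Ω → IsRingDecomp N₀ c₀ β n₀ Ω →
        ∀ n : ℕ, n₀ ≤ n → ∀ S₁ S₂ : Plane → ℝ,
          IsSpline N₀ c₀ β n 1 Ω S₁ → IsSpline N₀ c₀ β n 1 Ω S₂ →
          bvSeminorm Ω S₁ ≤
            bvSeminorm Ω S₂ +
              ENNReal.ofReal (c * (n : ℝ) ^ ((1 : ℝ) / 2)) *
                lpNormE 2 Ω (fun x => S₁ x - S₂ x) := by
  have hβ₂ : β < Real.pi / 2 := by linarith [Real.pi_pos]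
  have hcos : 0 < Real.cos β := Real.cos_pos_of_mem_Ioo ⟨by linarith, hβ₂⟩
  have hsin : 0 < Real.sin β := Real.sin_pos_of_pos_of_lt_pi hβ (by linarith)
  set τ := Real.sin β / (1 + Real.cos β)
  have hτ : 0 < τ := by positivity
  have hK : 0 ≤ packingBound τ := sq_nonneg _
  set c := (1 + 2 / τ) * ((1 + packingBound τ) * (8 * N₀)) ^ ((1 : ℝ) / 2) with hc
  have hc0 : 0 ≤ c := by positivity
  refine ⟨c + 1, by positivity, fun Ω n₀ hΩ _ n _ S₁ S₂ h₁ h₂ => ?_⟩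
  obtain ⟨R, ι, _, e, a, hP, hcard, rfl⟩ := h₁.exists_edgePartition hβ hβ₂ hΩ
  obtain ⟨R', κ, _, e', a', hP', hcard', rfl⟩ := h₂.exists_edgePartition hβ hβ₂ hΩ
  refine (hP.bvSeminorm_le hτ hΩ hP' a a').trans ?_
  rw [lpNormE, show ENNReal.ofReal 2 = 2 by simp]
  gcongr
  rw [ENNReal.ofReal_rpow_of_nonneg (by positivity) (by norm_num),
    ← ENNReal.ofReal_mul (by positivity)]
  apply ENNReal.ofReal_le_ofReal
  have h1 : (Fintype.card (Σ i, ι i) : ℝ) ≤ n * (4 * N₀) := by exact_mod_cast hcard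
  have h2 : (Fintype.card (Σ i, κ i) : ℝ) ≤ n * (4 * N₀) := by exact_mod_cast hcard'
  calc _ ≤ (1 + 2 / τ) * ((1 + packingBound τ) * (8 * N₀) * n) ^ ((1 : ℝ) / 2) := by
        refine mul_le_mul_of_nonneg_left (Real.rpow_le_rpow (by positivity) ?_ (by norm_num))
          (by positivity)
        rw [mul_assoc]
        exact mul_le_mul_of_nonneg_left (by linarith) (by positivity)
    _ = c * (n : ℝ) ^ ((1 : ℝ) / 2) := by
        rw [Real.mul_rpow (by positivity) (by positivity), hc]; ring
    _ ≤ (c + 1) * (n : ℝ) ^ ((1 : ℝ) / 2) := by gcongr; linarith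

end
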